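/- arXiv:2308.06660 — 2 statements merged into one kernel-verified Lean document; each statement's English description precedes it below -/
import Mathlib

section
/- Let T be a reduced tree with at least three leaves and let a and b be distinct leaves of T. Then a and b are separated in the leaf structure L(T), relative to the Fraïssé class 𝔗, if and only if one of the following holds: (a) N(a) and N(b) are distinct and not adjacent; or (b) N(a) and N(b) are distinct and at least one of them has valence ≥ 4. -/
/-! # Relational structures, embeddings, amalgamations, Fraïssé classes -/

namespace Paper

/-- A relational signature: a set `I` of relation symbols with arities `≥ 1`. -/
structure Signature : Type 1 where
  I : Type
  arity : I → ℕ
  arity_pos : ∀ i, 1 ≤ arity i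

variable {σ : Signature}

/-- A (finite relational) structure for the signature `σ`. -/
structure Struc (σ : Signature) : Type 1 where
  carrier : Type
  [fin : Finite carrier]
  rel : ∀ i : σ.I, (Fin (σ.arity i) → carrier) → Prop

attribute [instance] Struc.fin

/-- An embedding of structures: an injection under which the relations on the source are
exactly the restrictions of the relations on the target. -/
structure Emb (X Y : Struc σ) : Type where
  toFun : X.carrier → Y.carrier
  inj : Function.Injective toFun
  rel_iff : ∀ (i : σ.I) (v : Fin (σ.arity i) → X.carrier),
    Y.rel i (fun j => toFun (v j)) ↔ X.rel i v

/-- The identity embedding. -/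
def Emb.id (X : Struc σ) : Emb X X where
  toFun := fun x => x
  inj := fun _ _ h => h
  rel_iff := fun _ _ => Iff.rfl

/-- Composition of embeddings. -/
def Emb.comp {X Y Z : Struc σ} (g : Emb Y Z) (f : Emb X Y) : Emb X Z where
  toFun := fun x => g.toFun (f.toFun x)
  inj := fun _ _ h => f.inj (g.inj h)
  rel_iff := fun i v => (g.rel_iff i fun j => f.toFun (v j)).trans (f.rel_iff i v)

/-- An embedding is an isomorphism if it is surjective. -/
def Emb.IsIso {X Y : Struc σ} (f : Emb X Y) : Prop := Function.Surjective f.toFun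

/-- Two structures are isomorphic. -/
def StrucIso (X Y : Struc σ) : Prop := ∃ f : Emb X Y, f.IsIso

theorem strucIso_refl (X : Struc σ) : StrucIso X X := ⟨Emb.id X, fun y => ⟨y, rfl⟩⟩

/-- The induced structure on a subset of the carrier. -/
def Struc.restrict (X : Struc σ) (S : Set X.carrier) : Struc σ where
  carrier := S
  rel := fun i v => X.rel i (fun j => (v j : X.carrier))

/-- The inclusion embedding of an induced substructure into the whole structure. -/
def Struc.subEmb (X : Struc σ) (S : Set X.carrier) : Emb (X.restrict S) X where
  toFun := fun a => a.1
  inj := fun _ _ h => Subtype.ext h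
  rel_iff := fun _ _ => Iff.rfl

/-- The inclusion embedding between induced substructures on nested subsets. -/
def Struc.inclEmb (X : Struc σ) {S T : Set X.carrier} (h : S ⊆ T) :
    Emb (X.restrict S) (X.restrict T) where
  toFun := fun a => ⟨a.1, h a.2⟩
  inj := fun a b hab => Subtype.ext (Subtype.mk_eq_mk.mp (by exact hab))
  rel_iff := fun _ _ => Iff.rfl

/-- An amalgamation of `Y₁` and `Y₂` over `X` (along `i₁`, `i₂`). -/
structure Amalg {X Y₁ Y₂ : Struc σ} (i₁ : Emb X Y₁) (i₂ : Emb X Y₂) : Type 1 where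
  Z : Struc σ
  j₁ : Emb Y₁ Z
  j₂ : Emb Y₂ Z
  comm : ∀ x, j₁.toFun (i₁.toFun x) = j₂.toFun (i₂.toFun x)
  surj : ∀ z, z ∈ Set.range j₁.toFun ∪ Set.range j₂.toFun

/-- Isomorphism of amalgamations: a structure isomorphism commuting with the two
embeddings. -/
def Amalg.Iso {X Y₁ Y₂ : Struc σ} {i₁ : Emb X Y₁} {i₂ : Emb X Y₂}
    (A B : Amalg i₁ i₂) : Prop :=
  ∃ f : Emb A.Z B.Z, f.IsIso ∧ (∀ y, f.toFun (A.j₁.toFun y) = B.j₁.toFun y) ∧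
    (∀ y, f.toFun (A.j₂.toFun y) = B.j₂.toFun y)

/-- A structure lies in the class `F` up to isomorphism. -/
def MemUpIso (F : Set (Struc σ)) (X : Struc σ) : Prop := ∃ W ∈ F, StrucIso X W

theorem memUpIso_of_mem {F : Set (Struc σ)} {X : Struc σ} (h : X ∈ F) : MemUpIso F X :=
  ⟨X, h, strucIso_refl X⟩

/-- A Fraïssé class. -/
structure IsFraisse (F : Set (Struc σ)) : Prop where
  nonempty : F.Nonempty
  finClasses : ∀ n : ℕ, ∃ (m : ℕ) (r : Fin m → Struc σ),
    ∀ X ∈ F, Nat.card X.carrier = n → ∃ α, StrucIso X (r α)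
  hereditary : ∀ X ∈ F, ∀ Y : Struc σ, Nonempty (Emb Y X) → MemUpIso F Y
  amalg : ∀ (X Y₁ Y₂ : Struc σ), X ∈ F → Y₁ ∈ F → Y₂ ∈ F →
    ∀ (i₁ : Emb X Y₁) (i₂ : Emb X Y₂), ∃ A : Amalg i₁ i₂, MemUpIso F A.Z

theorem pair_compl_subset_left {α : Type*} (a b : α) : ({a, b} : Set α)ᶜ ⊆ ({a} : Set α)ᶜ :=
  Set.compl_subset_compl.mpr (fun _ hx => Set.mem_insert_iff.mpr (Or.inl hx))

theorem pair_compl_subset_right {α : Type*} (a b : α) : ({a, b} : Set α)ᶜ ⊆ ({b} : Set α)ᶜ :=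
  Set.compl_subset_compl.mpr (fun _ hx => Set.mem_insert_iff.mpr (Or.inr hx))

/-- The canonical amalgamation of `X∖{a}` and `X∖{b}` over `X∖{a,b}`, namely `X` itself. -/
def canonAmalg (X : Struc σ) (a b : X.carrier) (hab : a ≠ b) :
    Amalg (X.inclEmb (pair_compl_subset_left a b)) (X.inclEmb (pair_compl_subset_right a b)) where
  Z := X
  j₁ := X.subEmb ({a} : Set X.carrier)ᶜ
  j₂ := X.subEmb ({b} : Set X.carrier)ᶜ
  comm := fun _ => rfl
  surj := fun z => by
    by_cases hz : z = a
    · exact Or.inr ⟨⟨z, by simp only [Set.mem_compl_iff, Set.mem_singleton_iff, hz]; exact hab⟩, rfl⟩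
    · exact Or.inl ⟨⟨z, by simp [hz]⟩, rfl⟩

/-- Two distinct elements `a b` of `X` are separated (relative to the class `F`) if `X` is,
up to isomorphism of amalgamations, the unique amalgamation of `X∖{a}` and `X∖{b}` over
`X∖{a,b}` lying in `F`. -/
def Separated (F : Set (Struc σ)) (X : Struc σ) (a b : X.carrier) (hab : a ≠ b) : Prop :=
  ∀ A : Amalg (X.inclEmb (pair_compl_subset_left a b)) (X.inclEmb (pair_compl_subset_right a b)),
    MemUpIso F A.Z → A.Iso (canonAmalg X a b hab)

/-- Stably separated: every embedding into a member of `F` sends `a`, `b` to separated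
elements. -/
def StablySeparated (F : Set (Struc σ)) (X : Struc σ) (a b : X.carrier) (hab : a ≠ b) : Prop :=
  ∀ X' : Struc σ, MemUpIso F X' → ∀ f : Emb X X',
    Separated F X' (f.toFun a) (f.toFun b) (fun h => hab (f.inj h))

/-- Isomorphism of marked structures. -/
def MarkedIso (X : Struc σ) (a : X.carrier) (Y : Struc σ) (b : Y.carrier) : Prop :=
  ∃ f : Emb X Y, f.IsIso ∧ f.toFun a = b

/-- `b` is extraneous in the marked structure `(X, a)` if it is separated from `a`. -/
def Extraneous (F : Set (Struc σ)) (X : Struc σ) (a b : X.carrier) : Prop :=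
  ∃ h : a ≠ b, Separated F X a b h

/-- A marked structure is minimal if it has no extraneous elements. -/
def MinimalMarked (F : Set (Struc σ)) (X : Struc σ) (a : X.carrier) : Prop :=
  ∀ b : X.carrier, ¬ Extraneous F X a b

/-- `f : W → X` is a one-point extension missing exactly `a`. -/
def IsOnePointExt {W X : Struc σ} (f : Emb W X) (a : X.carrier) : Prop :=
  Set.range f.toFun = ({a} : Set X.carrier)ᶜ

end Paper

/-! # Trees and tree structures -/

namespace Paper

/-- A finite tree: a finite connected acyclic simple graph. -/
structure FinTree : Type 1 where
  V : Type
  [fin : Fintype V]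
  [dec : DecidableEq V]
  G : SimpleGraph V
  [adjDec : DecidableRel G.Adj]
  isTree : G.IsTree

attribute [instance] FinTree.fin FinTree.dec FinTree.adjDec

/-- A leaf is a vertex of valence `≤ 1` (in a tree with at least two vertices this is the
same as valence exactly `1`; in a tree with at most two vertices every vertex is a leaf). -/
def FinTree.IsLeaf (T : FinTree) (v : T.V) : Prop := T.G.degree v ≤ 1

instance (T : FinTree) : DecidablePred T.IsLeaf := fun v => by
  unfold FinTree.IsLeaf; infer_instance

/-- A node is a vertex which is not a leaf. -/
def FinTree.IsNode (T : FinTree) (v : T.V) : Prop := ¬ T.IsLeaf v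

/-- A tree is reduced if it has no node of valence 2. -/
def FinTree.Reduced (T : FinTree) : Prop := ∀ v : T.V, T.G.degree v ≠ 2

/-- The quaternary relation on the vertices of a tree: the four vertices are pairwise
distinct and the path from `x₁` to `x₂` has a common edge with the path from `y₁` to
`y₂`. -/
def FinTree.pathRel (T : FinTree) (x₁ x₂ y₁ y₂ : T.V) : Prop :=
  ([x₁, x₂, y₁, y₂] : List T.V).Nodup ∧
  ∃ (p : T.G.Walk x₁ x₂) (q : T.G.Walk y₁ y₂), p.IsPath ∧ q.IsPath ∧
    ∃ e : Sym2 T.V, e ∈ p.edges ∧ e ∈ q.edges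

/-- The signature of tree structures: a single quaternary relation. -/
abbrev treeSig : Signature where
  I := Unit
  arity := fun _ => 4
  arity_pos := fun _ => by norm_num

/-- The leaf structure `L(T)` of a tree `T`: the set of leaves together with the quaternary
relation `R(x₁,x₂;y₁,y₂)` expressing that the paths `x₁–x₂` and `y₁–y₂` share an edge. -/
def FinTree.leafStruc (T : FinTree) : Struc treeSig where
  carrier := {v : T.V // T.IsLeaf v}
  rel := fun _ v => T.pathRel (v 0).1 (v 1).1 (v 2).1 (v 3).1

/-- The class `𝔗` of all tree structures (together with the empty structure, the leaf
structure of the empty tree). -/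
def TreeClass : Set (Struc treeSig) :=
  {A | IsEmpty A.carrier ∨ ∃ T : FinTree, StrucIso A T.leafStruc}

/-- The level of a tree is at most `n`: every vertex has valence at most `n`. -/
def FinTree.LevelLe (T : FinTree) (n : ℕ) : Prop := ∀ v : T.V, T.G.degree v ≤ n

/-- The class `𝔗_n` of tree structures of level at most `n`. -/
def TreeClassN (n : ℕ) : Set (Struc treeSig) :=
  {A | IsEmpty A.carrier ∨ ∃ T : FinTree, T.LevelLe n ∧ StrucIso A T.leafStruc}

theorem leafStruc_mem_treeClass (T : FinTree) : T.leafStruc ∈ TreeClass :=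
  Or.inr ⟨T, strucIso_refl _⟩

/-- The set of leaves of a tree. -/
def FinTree.leafFinset (T : FinTree) : Finset T.V := Finset.univ.filter T.IsLeaf

/-- The number of leaves, `ℓ(T)`. -/
def FinTree.nLeaves (T : FinTree) : ℕ := T.leafFinset.card

/-- The set of nodes of a tree. -/
def FinTree.nodeFinset (T : FinTree) : Finset T.V := Finset.univ.filter (fun v => ¬ T.IsLeaf v)

/-- The number of nodes, `n(T)`. -/
def FinTree.nNodes (T : FinTree) : ℕ := T.nodeFinset.card

end Paper

namespace Paper

section Quartets

variable {α : Type*}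

/-- The quaternary relation cut out by a family of pairwise compatible bipartitions: two pairs
are related when a single bipartition separates both of them. -/
def IsSplitRel (R : α → α → α → α → Prop) : Prop :=
  ∃ (ι : Type) (side : ι → α → Prop),
    (∀ i j p q r s, side i p → side j p → side i q → ¬ side j q → ¬ side i r → side j r →
      ¬ side i s → side j s) ∧
    ∀ p q r s, R p q r s ↔ [p, q, r, s].Nodup ∧
      ∃ i, ¬ (side i p ↔ side i q) ∧ ¬ (side i r ↔ side i s)

/-- The resolved quartet `pq|rs` of a split relation. -/
def Quartet (R : α → α → α → α → Prop) (p q r s : α) : Prop :=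
  R p r q s ∧ ¬ R p q r s

/-- The axioms of a system of resolved quartets (a `D`-relation). -/
structure IsQuartetSystem (D : α → α → α → α → Prop) : Prop where
  swap : ∀ {p q r s}, D p q r s → D q p r s
  flip : ∀ {p q r s}, D p q r s → D r s p q
  ne : ∀ {p q r s}, D p q r s → p ≠ q ∧ p ≠ r
  excl : ∀ {p q r s}, D p q r s → ¬ D p r q s
  extend : ∀ {p q r s} (e), D p q r s → e ≠ p → e ≠ q → e ≠ r → e ≠ s →
    (D e q r s ∧ D p e r s) ∨ (D p q e s ∧ D p q r e)

theorem IsSplitRel.comap {β : Type*} {R : α → α → α → α → Prop} (h : IsSplitRel R)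
    {f : β → α} (hf : Function.Injective f) :
    IsSplitRel fun p q r s => R (f p) (f q) (f r) (f s) := by
  obtain ⟨ι, side, hc, hR⟩ := h
  refine ⟨ι, fun i v => side i (f v), fun i j p q r s => hc i j _ _ _ _, fun p q r s => ?_⟩
  simp only [hR]
  simp [hf.eq_iff]

theorem IsSplitRel.quartet_iff {R : α → α → α → α → Prop} {ι : Type} {side : ι → α → Prop}
    (hc : ∀ i j p q r s, side i p → side j p → side i q → ¬ side j q → ¬ side i r → side j r →
      ¬ side i s → side j s)
    (hR : ∀ p q r s, R p q r s ↔ [p, q, r, s].Nodup ∧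
      ∃ i, ¬ (side i p ↔ side i q) ∧ ¬ (side i r ↔ side i s)) (p q r s : α) :
    Quartet R p q r s ↔ [p, q, r, s].Nodup ∧
      ∃ i, (side i p ↔ side i q) ∧ (side i r ↔ side i s) ∧ ¬ (side i p ↔ side i r) := by
  have hn : [p, r, q, s].Nodup ↔ [p, q, r, s].Nodup := by simp; grind
  rw [Quartet, hR, hR, hn]
  constructor
  · rintro ⟨⟨h, i, hi⟩, h'⟩
    refine ⟨h, i, ?_⟩
    have : ¬ (¬ (side i p ↔ side i q) ∧ ¬ (side i r ↔ side i s)) := fun h'' => h' ⟨h, i, h''⟩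
    tauto
  · rintro ⟨h, i, hi⟩
    refine ⟨⟨h, i, by tauto⟩, ?_⟩
    rintro ⟨-, j, hj⟩
    by_cases hip : side i p <;> by_cases hjp : side j p <;> by_cases hjr : side j r <;>
      grind

theorem IsSplitRel.isQuartetSystem {R : α → α → α → α → Prop} (h : IsSplitRel R) :
    IsQuartetSystem (Quartet R) := by
  obtain ⟨ι, side, hc, hR⟩ := h
  have hQ := IsSplitRel.quartet_iff hc hR
  constructor
  · intro p q r s
    rw [hQ, hQ]
    rintro ⟨h, i, hi⟩
    exact ⟨by simp at h ⊢; grind, i, by tauto⟩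
  · intro p q r s
    rw [hQ, hQ]
    rintro ⟨h, i, hi⟩
    exact ⟨by simp at h ⊢; grind, i, by tauto⟩
  · intro p q r s
    rw [hQ]
    rintro ⟨h, -⟩
    simp at h
    tauto
  · rintro p q r s h h'
    exact h'.2 h.1
  · intro p q r s e
    simp only [hQ]
    rintro ⟨h, i, hi⟩ h1 h2 h3 h4
    by_cases he : side i e ↔ side i p
    · refine Or.inl ⟨⟨by simp at h ⊢; grind, i, by tauto⟩, ⟨by simp at h ⊢; grind, i, by tauto⟩⟩
    · refine Or.inr ⟨⟨by simp at h ⊢; grind, i, by tauto⟩, ⟨by simp at h ⊢; grind, i, by tauto⟩⟩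

theorem IsSplitRel.iff_quartet {R : α → α → α → α → Prop} (h : IsSplitRel R) (p q r s : α) :
    R p q r s ↔ Quartet R p r q s ∨ Quartet R p s q r := by
  obtain ⟨ι, side, hc, hR⟩ := h
  rw [IsSplitRel.quartet_iff hc hR, IsSplitRel.quartet_iff hc hR, hR]
  have h1 : [p, r, q, s].Nodup ↔ [p, q, r, s].Nodup := by simp; grind
  have h2 : [p, s, q, r].Nodup ↔ [p, q, r, s].Nodup := by simp; grind
  rw [h1, h2, ← and_or_left, ← exists_or]
  refine and_congr_right fun _ => exists_congr fun i => ?_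
  tauto

theorem IsSplitRel.perm {R : α → α → α → α → Prop} (h : IsSplitRel R) (p q r s : α) :
    (R p q r s ↔ R q p r s) ∧ (R p q r s ↔ R p q s r) ∧ (R p q r s ↔ R r s p q) := by
  obtain ⟨ι, side, hc, hR⟩ := h
  simp only [hR]
  refine ⟨and_congr (by simp; grind) (exists_congr fun i => by tauto),
    and_congr (by simp; grind) (exists_congr fun i => by tauto),
    and_congr (by simp; grind) (exists_congr fun i => by tauto)⟩

theorem IsSplitRel.nodup {R : α → α → α → α → Prop} (h : IsSplitRel R) {p q r s : α}
    (hR : R p q r s) : [p, q, r, s].Nodup := by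
  obtain ⟨ι, side, hc, hR'⟩ := h
  exact ((hR' _ _ _ _).1 hR).1

namespace IsQuartetSystem

variable {D : α → α → α → α → Prop}

theorem swap_right (h : IsQuartetSystem D) {p q r s : α} (hD : D p q r s) : D p q s r :=
  h.flip (h.swap (h.flip hD))

theorem nodup (h : IsQuartetSystem D) {p q r s : α} (hD : D p q r s) :
    p ≠ q ∧ p ≠ r ∧ p ≠ s ∧ q ≠ r ∧ q ≠ s ∧ r ≠ s :=
  ⟨(h.ne hD).1, (h.ne hD).2, (h.ne (h.swap_right hD)).2, (h.ne (h.swap hD)).2,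
    (h.ne (h.swap (h.swap_right hD))).2, (h.ne (h.flip hD)).1⟩

theorem excl' (h : IsQuartetSystem D) {p q r s : α} (hD : D p q r s) : ¬ D p s q r :=
  fun h' => h.excl (h.swap_right hD) (h.swap_right (h.swap_right h'))

/-- A leaf `x` forming a cherry with `a` relative to `b`, `u`, `v` may replace `a` in the
quartet `ab|uv`. -/
theorem replace (h : IsQuartetSystem D) {a b x u v : α} (h1 : D a x b u) (h2 : D a x b v)
    (h3 : D a x u v) : D a b u v ↔ D x b u v := by
  have n1 := h.nodup h1
  have n2 := h.nodup h2
  have n3 := h.nodup h3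
  constructor
  · intro hD
    rcases h.extend x hD n1.1.symm n1.2.2.2.1 n1.2.2.2.2.1 n2.2.2.2.2.1 with hE | hE
    · exact hE.1
    · exact absurd h2 (h.excl hE.1)
  · intro hD
    rcases h.extend a hD n1.1 n1.2.1 n1.2.2.1 n2.2.2.1 with hE | hE
    · exact hE.1
    · exact absurd (h.swap h2) (h.excl hE.1)

theorem cherry_pair (h : IsQuartetSystem D) {a b x u v : α} (h1 : D a x b u) (h2 : D a x b v)
    (huv : u ≠ v) : D a x u v := by
  have n1 := h.nodup h1
  have n2 := h.nodup h2
  rcases h.extend v h1 n2.2.2.1.symm n2.2.2.2.2.1.symm n2.2.2.2.2.2.symm huv.symm with hE | hE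
  · rcases h.extend u h2 n1.2.2.1.symm n1.2.2.2.2.1.symm n1.2.2.2.2.2.symm huv with hF | hF
    · exact absurd (h.swap_right (h.swap hF.1)) (h.excl' (h.swap hE.1))
    · exact hF.1
  · exact h.swap_right hE.1

theorem cherry_of_replace (h : IsQuartetSystem D) {a b x u v : α} (h1 : D a x b u)
    (h2 : D v x b u) (hva : v ≠ a) : D a v b u := by
  have n1 := h.nodup h1
  have n2 := h.nodup h2
  rcases h.extend v h1 hva n2.1 n2.2.1 n2.2.2.1 with hE | hE
  · exact hE.2
  · exact (h.replace (h.swap_right hE.2) hE.1 h1).2 (h.swap h2)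

theorem cherry_move (h : IsQuartetSystem D) {a b x y u : α} (h1 : D a x b y) (h2 : D a x u y)
    (hub : u ≠ b) : D a x b u :=
  h.cherry_pair (h.swap_right h1) (h.swap_right h2) hub.symm

theorem agree_of_cherry {D' : α → α → α → α → Prop} (h : IsQuartetSystem D)
    (h' : IsQuartetSystem D') {a b x u v : α}
    (hagree : ∀ p q r s, a ∉ [p, q, r, s] ∨ b ∉ [p, q, r, s] → (D p q r s ↔ D' p q r s))
    (hD : D a x b u) (hD' : D' a x b u) (hva : v ≠ a) (hvb : v ≠ b) (hvu : v ≠ u) :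
    (D a b u v → D' a b u v) ∧ (D a u b v → D' a u b v) ∧ (D a v b u → D' a v b u) := by
  have n1 := h.nodup hD
  by_cases hc : v = x ∨ D v x b u
  · have h1 : D a v b u := hc.elim (fun e => e ▸ hD) fun e => h.cherry_of_replace hD e hva
    have h2 : D' a v b u := hc.elim (fun e => e ▸ hD') fun e =>
      h'.cherry_of_replace hD' ((hagree _ _ _ _ (Or.inl (by simp; grind))).1 e) hva
    exact ⟨fun e => absurd (h.swap_right e) (h.excl h1),
      fun e => absurd (h.swap_right e) (h.excl' h1), fun _ => h2⟩
  · have h1 : D a x b v := by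
      rcases h.extend v hD hva (by grind) hvb hvu with hE | hE
      · grind
      · exact hE.2
    have h2 : D' a x b v := by
      rcases h'.extend v hD' hva (by grind) hvb hvu with hE | hE
      · exact absurd ((hagree _ _ _ _ (Or.inl (by simp; grind))).2 hE.1) (by grind)
      · exact hE.2
    have h3 := h.cherry_pair hD h1 hvu.symm
    have h3' := h'.cherry_pair hD' h2 hvu.symm
    rw [h.replace hD h1 h3, h'.replace hD' h2 h3', h.replace (h.swap_right hD) h3 h1,
      h'.replace (h'.swap_right hD') h3' h2, h.replace (h.swap_right h1) (h.swap_right h3) hD,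
      h'.replace (h'.swap_right h2) (h'.swap_right h3') hD',
      hagree _ _ _ _ (Or.inl (by simp; grind)), hagree _ _ _ _ (Or.inl (by simp; grind)),
      hagree _ _ _ _ (Or.inl (by simp; grind))]
    exact ⟨id, id, id⟩

/-- If `ax|by`, then all quartets containing `a` and `b` are determined by the others. -/
theorem of_agree {D' : α → α → α → α → Prop} (h : IsQuartetSystem D)
    (h' : IsQuartetSystem D') {a b x y : α}
    (hagree : ∀ p q r s, a ∉ [p, q, r, s] ∨ b ∉ [p, q, r, s] → (D p q r s ↔ D' p q r s))
    (hD : D a x b y) (hD' : D' a x b y) {p q r s : α} (hpq : D p q r s) : D' p q r s := by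
  have key : ∀ u v, u ≠ a → u ≠ b → v ≠ a → v ≠ b → v ≠ u →
      (D a b u v → D' a b u v) ∧ (D a u b v → D' a u b v) ∧ (D a v b u → D' a v b u) := by
    intro u v hua hub hva hvb hvu
    have n := h.nodup hD
    have hB : (D a x b u ∧ D' a x b u) ∨ (D b y a u ∧ D' b y a u) := by
      by_cases hux : u = x
      · subst hux
        exact Or.inr ⟨h.flip hD, h'.flip hD'⟩
      by_cases huy : u = y
      · exact Or.inl (huy ▸ ⟨hD, hD'⟩)
      rcases h.extend u hD hua hux hub huy with hE | hE
      · have hE' := (hagree _ _ _ _ (Or.inl (by simp; grind))).1 hE.1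
        refine Or.inr ⟨?_, ?_⟩
        · exact h.cherry_move (h.flip hD) (h.flip hE.1) hua
        · exact h'.cherry_move (h'.flip hD') (h'.flip hE') hua
      · have hE' := (hagree _ _ _ _ (Or.inr (by simp; grind))).1 hE.1
        exact Or.inl ⟨hE.2, h'.cherry_move hD' hE' hub⟩
    rcases hB with ⟨h1, h2⟩ | ⟨h1, h2⟩
    · exact h.agree_of_cherry h' hagree h1 h2 hva hvb hvu
    · have := h.agree_of_cherry h' (fun p q r s e => hagree p q r s e.symm) h1 h2 hvb hva hvu
      exact ⟨fun e => h'.swap (this.1 (h.swap e)),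
        fun e => h'.flip (this.2.2 (h.flip e)), fun e => h'.flip (this.2.1 (h.flip e))⟩
  by_cases ha : a ∈ [p, q, r, s]
  swap
  · exact (hagree _ _ _ _ (Or.inl ha)).1 hpq
  by_cases hb : b ∈ [p, q, r, s]
  swap
  · exact (hagree _ _ _ _ (Or.inr hb)).1 hpq
  have n := h.nodup hpq
  have n0 := h.nodup hD
  have s1 := @IsQuartetSystem.swap _ _ h
  have s2 := @IsQuartetSystem.flip _ _ h
  have s1' := @IsQuartetSystem.swap _ _ h'
  have s2' := @IsQuartetSystem.flip _ _ h'
  simp only [List.mem_cons, List.not_mem_nil, or_false] at ha hb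
  rcases ha with rfl | rfl | rfl | rfl <;> rcases hb with rfl | rfl | rfl | rfl <;> grind

end IsQuartetSystem

theorem IsSplitRel.quartet_of_witness {R : α → α → α → α → Prop} (h : IsSplitRel R)
    {a b x y z : α} (hx : b ≠ x) (hy : b ≠ y) (hz : b ≠ z) (hb : ¬ R b y x z)
    (ha : Quartet R a x y z) (hab : b ≠ a) : Quartet R a x b y := by
  have hQ := h.isQuartetSystem
  rcases hQ.extend b ha hab hx hy hz with hE | hE
  · exact absurd ((h.iff_quartet _ _ _ _).2 (Or.inl hE.1)) hb
  · exact hQ.swap_right hE.2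

/-- Two split relations agreeing away from `{a, b}` coincide as soon as `a` and `b` are
distinguished by three further elements. -/
theorem IsSplitRel.iff_of_agree {R R' : α → α → α → α → Prop} (h : IsSplitRel R)
    (h' : IsSplitRel R') {a b x y z : α} (hab : a ≠ b) (hx : b ≠ x) (hy : b ≠ y) (hz : b ≠ z)
    (hagree : ∀ p q r s, a ∉ [p, q, r, s] ∨ b ∉ [p, q, r, s] → (R p q r s ↔ R' p q r s))
    (ha : R a y x z) (hb : ¬ R b y x z) (p q r s : α) : R p q r s ↔ R' p q r s := by
  have hQ := h.isQuartetSystem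
  have hQ' := h'.isQuartetSystem
  have hn := h.nodup ha
  have hagree' : ∀ p q r s, a ∉ [p, q, r, s] ∨ b ∉ [p, q, r, s] →
      (Quartet R p q r s ↔ Quartet R' p q r s) := by
    intro p q r s hpq
    rw [Quartet, Quartet, hagree p q r s hpq, hagree p r q s (by simpa [and_left_comm] using hpq)]
  have hb' : ¬ R' b y x z := by
    rwa [← hagree _ _ _ _ (Or.inl (by simp at hn ⊢; grind))]
  obtain ⟨w, hD, hD'⟩ : ∃ w, Quartet R a w b y ∧ Quartet R' a w b y := by
    rcases (h.iff_quartet _ _ _ _).1 ha with h1 | h1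
    · exact ⟨x, h.quartet_of_witness hx hy hz hb h1 hab.symm, h'.quartet_of_witness hx hy hz hb'
        ((hagree' _ _ _ _ (Or.inr (by simp; grind))).1 h1) hab.symm⟩
    · rw [(h.perm _ _ _ _).2.1] at hb
      rw [(h'.perm _ _ _ _).2.1] at hb'
      exact ⟨z, h.quartet_of_witness hz hy hx hb h1 hab.symm, h'.quartet_of_witness hz hy hx hb'
        ((hagree' _ _ _ _ (Or.inr (by simp; grind))).1 h1) hab.symm⟩
  have key : ∀ p q r s, Quartet R p q r s ↔ Quartet R' p q r s := fun p q r s =>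
    ⟨fun e => hQ.of_agree hQ' hagree' hD hD' e,
      fun e => hQ'.of_agree hQ (fun p q r s e => (hagree' p q r s e).symm) hD' hD e⟩
  rw [h.iff_quartet, h'.iff_quartet, key, key]

end Quartets

section Sides

variable {V : Type} {G : SimpleGraph V}

/-- `v` lies on the `w`-side of the edge `uw`. -/
def Side (G : SimpleGraph V) (u w v : V) : Prop :=
  (G.deleteEdges {s(u, w)}).Reachable w v

theorem side_self (u w : V) : Side G u w w := SimpleGraph.Reachable.refl _

theorem not_side (hG : G.IsTree) {u w : V} (huw : G.Adj u w) : ¬ Side G u w u := fun h =>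
  SimpleGraph.isBridge_iff.1
    (SimpleGraph.isAcyclic_iff_forall_adj_isBridge.1 hG.isAcyclic huw) h.symm

theorem side_iff_of_reachable {u w x y : V} (h : (G.deleteEdges {s(u, w)}).Reachable x y) :
    Side G u w x ↔ Side G u w y :=
  ⟨fun h' => h'.trans h, fun h' => h'.trans h.symm⟩

theorem side_iff_of_adj {u w x y : V} (h : G.Adj x y) (hne : s(x, y) ≠ s(u, w)) :
    Side G u w x ↔ Side G u w y := by
  apply side_iff_of_reachable
  apply SimpleGraph.Adj.reachable
  rw [SimpleGraph.deleteEdges_adj]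
  exact ⟨h, by simpa using hne⟩

theorem side_or (hG : G.IsTree) (u w v : V) : Side G u w v ∨ Side G w u v := by
  obtain ⟨p⟩ := hG.connected.preconnected v u
  induction p with
  | nil => exact Or.inr (side_self _ _)
  | @cons x y u h p ih =>
    by_cases hxy : s(x, y) = s(u, w)
    · rcases Sym2.eq_iff.1 hxy with ⟨rfl, rfl⟩ | ⟨rfl, rfl⟩
      · exact Or.inr (side_self _ _)
      · exact Or.inl (side_self _ _)
    · rw [side_iff_of_adj h hxy, side_iff_of_adj h (Sym2.eq_swap (a := u) ▸ hxy)]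
      exact ih

theorem side_swap (hG : G.IsTree) {u w : V} (huw : G.Adj u w) (v : V) :
    Side G w u v ↔ ¬ Side G u w v := by
  constructor
  · intro h h'
    rw [Side, Sym2.eq_swap] at h
    exact not_side hG huw (h'.trans h.symm)
  · exact (side_or hG u w v).resolve_left

theorem reachable_iff_side (hG : G.IsTree) {u w : V} (huw : G.Adj u w) (x y : V) :
    (G.deleteEdges {s(u, w)}).Reachable x y ↔ (Side G u w x ↔ Side G u w y) := by
  refine ⟨side_iff_of_reachable, fun h => ?_⟩
  by_cases hx : Side G u w x
  · exact hx.symm.trans (h.1 hx)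
  · have hy : ¬ Side G u w y := fun hy => hx (h.2 hy)
    rw [← side_swap hG huw, Side, Sym2.eq_swap] at hx hy
    exact hx.symm.trans hy

theorem side_iff_of_walk {u w x y : V} (p : G.Walk x y) (h : u ∉ p.support ∨ w ∉ p.support) :
    Side G u w x ↔ Side G u w y :=
  side_iff_of_reachable <| SimpleGraph.reachable_deleteEdges_iff_exists_walk.2
    ⟨p, fun he => h.elim (fun h => h (p.fst_mem_support_of_mem_edges he))
      fun h => h (p.snd_mem_support_of_mem_edges he)⟩

theorem Side.exists_walk {u w v : V} (h : Side G u w v) :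
    ∃ p : G.Walk w v, ∀ c ∈ p.support, Side G u w c := by
  classical
  obtain ⟨p, hp⟩ := SimpleGraph.reachable_deleteEdges_iff_exists_walk.1 h
  refine ⟨p, fun c hc => ?_⟩
  exact SimpleGraph.reachable_deleteEdges_iff_exists_walk.2
    ⟨p.takeUntil c hc, fun he => hp (p.edges_takeUntil_subset_edges hc he)⟩

theorem Side.nested {u w v c d : V} (huw : G.Adj u w) (h : Side G u w v)
    (hc : ¬ Side G u w c) (hcu : c ≠ u) : Side G c d v ↔ Side G c d u := by
  obtain ⟨p, hp⟩ := h.exists_walk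
  rw [← side_iff_of_walk p (Or.inl fun h' => hc (hp _ h'))]
  apply side_iff_of_adj huw.symm
  intro he
  rcases Sym2.eq_iff.1 he with ⟨rfl, rfl⟩ | ⟨rfl, rfl⟩
  · exact hc (side_self _ _)
  · exact hcu rfl

theorem Side.branch (hG : G.IsTree) {u w w' v : V} (huw : G.Adj u w) (huw' : G.Adj u w')
    (hne : w ≠ w') (h : Side G u w v) : ¬ Side G u w' v := by
  obtain ⟨p, hp⟩ := h.exists_walk
  rw [← side_iff_of_walk p (Or.inl fun h' => not_side hG huw (hp _ h')),
    side_iff_of_adj huw.symm]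
  · exact not_side hG huw'
  · intro he
    rcases Sym2.eq_iff.1 he with ⟨rfl, rfl⟩ | ⟨rfl, -⟩
    · exact huw.ne rfl
    · exact hne rfl

theorem side_disjoint {u w p q v : V} (hp : ¬ Side G u w p) (hw : ¬ Side G p q w)
    (h : Side G u w v) : ¬ Side G p q v := by
  obtain ⟨r, hr⟩ := h.exists_walk
  rwa [← side_iff_of_walk r (Or.inl fun h' => hp (hr _ h'))]

theorem side_compat (hG : G.IsTree) {u w p q : V} (huw : G.Adj u w) (hpq : G.Adj p q)
    {a b c d : V} (ha : Side G u w a) (ha' : Side G p q a) (hb : Side G u w b)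
    (hb' : ¬ Side G p q b) (hc : ¬ Side G u w c) (hc' : Side G p q c) (hd : ¬ Side G u w d) :
    Side G p q d := by
  by_contra hd'
  by_cases he : s(u, w) = s(p, q)
  · rcases Sym2.eq_iff.1 he with ⟨rfl, rfl⟩ | ⟨rfl, rfl⟩
    · exact hb' hb
    · exact (side_swap hG huw a).1 ha' ha
  have h1 := side_iff_of_adj hpq (Ne.symm he)
  have h2 := side_iff_of_adj huw he
  have key : ∀ u w p q v, Side G u w v → Side G p q v → Side G u w p ∨ Side G p q w := by
    intro u w p q v hv hv'
    by_contra! h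
    exact side_disjoint h.1 h.2 hv hv'
  have k1 := key u w p q a ha ha'
  have k2 := key u w q p b hb ((side_swap hG hpq _).2 hb')
  have k3 := key w u p q c ((side_swap hG huw _).2 hc) hc'
  have k4 := key w u q p d ((side_swap hG huw _).2 hd) ((side_swap hG hpq _).2 hd')
  rw [side_swap hG hpq] at k2 k4
  rw [side_swap hG huw] at k3 k4
  tauto

theorem exists_adj_side (hG : G.IsTree) {u v : V} (h : v ≠ u) : ∃ w, G.Adj u w ∧ Side G u w v := by
  obtain ⟨p, hp⟩ := hG.connected.exists_isPath u v
  cases p with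
  | nil => exact absurd rfl h
  | @cons _ w _ hw p =>
    rw [SimpleGraph.Walk.cons_isPath_iff] at hp
    exact ⟨w, hw, (side_iff_of_walk p (Or.inl hp.2)).1 (side_self _ _)⟩

variable [Fintype V] [DecidableRel G.Adj]

theorem exists_adj_ne_of_card_lt [DecidableEq V] {v : V} (s : Finset V) (h : s.card < G.degree v) :
    ∃ r, G.Adj v r ∧ r ∉ s := by
  obtain ⟨r, hr, hrs⟩ := Finset.exists_mem_notMem_of_card_lt_card
    (s := s) (t := G.neighborFinset v) (by simpa using h)
  exact ⟨r, by simpa using hr, hrs⟩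

theorem eq_of_degree_le_one {v p q : V} (h : G.degree v ≤ 1) (hp : G.Adj v p) (hq : G.Adj v q) :
    p = q := by
  by_contra hne
  have := Finset.one_lt_card (s := G.neighborFinset v) |>.2 ⟨p, by simpa, q, by simpa, hne⟩
  rw [SimpleGraph.card_neighborFinset_eq_degree] at this
  omega

theorem Side.eq_leaf {b n v : V} (hG : G.IsTree) (hb : G.degree b ≤ 1) (hn : G.Adj b n)
    (h : Side G n b v) : v = b := by
  by_contra hne
  obtain ⟨p, hp⟩ := h.exists_walk
  cases p with
  | nil => exact hne rfl
  | @cons _ w _ hw p =>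
    obtain rfl := eq_of_degree_le_one hb hn hw
    exact not_side hG hn.symm (hp _ (by simp))

/-- Every side of an edge of a finite tree contains a leaf. -/
theorem exists_leaf_side (hG : G.IsTree) {u w : V} (huw : G.Adj u w) :
    ∃ v, G.degree v ≤ 1 ∧ Side G u w v := by
  classical
  induction hn : (Finset.univ.filter fun v => Side G u w v).card using Nat.strong_induction_on
    generalizing u w with
  | _ n ih =>
  by_cases hw : G.degree w ≤ 1
  · exact ⟨w, hw, side_self _ _⟩
  obtain ⟨x, hx, hxu⟩ : ∃ x, G.Adj w x ∧ x ≠ u := by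
    simpa using exists_adj_ne_of_card_lt {u} (by simp; omega : _ < G.degree w)
  have hsub : ∀ v, Side G w x v → Side G u w v := fun v hv => by
    by_contra h
    rw [← side_swap hG huw] at h
    exact hv.branch hG hx huw.symm hxu h
  obtain ⟨v, hv, hv'⟩ := ih _ (by
    rw [← hn]
    refine Finset.card_lt_card (Finset.ssubset_iff.2 ⟨w, ?_, ?_⟩)
    · simpa using not_side hG hx
    · intro v
      simp only [Finset.mem_insert, Finset.mem_filter, Finset.mem_univ, true_and]
      rintro (rfl | h)
      exacts [side_self _ _, hsub _ h]) hx rfl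
  exact ⟨v, hv, hsub v hv'⟩

end Sides


section TreeStructures

/-- The quaternary relation of a structure for the signature of tree structures. -/
def Struc.quat (X : Struc treeSig) (p q r s : X.carrier) : Prop := X.rel () ![p, q, r, s]

theorem Struc.rel_eq_quat (X : Struc treeSig) (i : treeSig.I)
    (v : Fin (treeSig.arity i) → X.carrier) : X.rel i v = X.quat (v 0) (v 1) (v 2) (v 3) := by
  unfold Struc.quat
  congr 1
  funext j
  change Fin 4 at j
  fin_cases j <;> rfl

theorem Emb.quat_iff {X Y : Struc treeSig} (f : Emb X Y) (p q r s : X.carrier) :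
    Y.quat (f.toFun p) (f.toFun q) (f.toFun r) (f.toFun s) ↔ X.quat p q r s := by
  have := f.rel_iff () ![p, q, r, s]
  rw [Y.rel_eq_quat] at this
  exact this

/-- An injection respecting the quaternary relation is an embedding. -/
def Emb.ofQuat {X Y : Struc treeSig} (f : X.carrier → Y.carrier) (hf : Function.Injective f)
    (h : ∀ p q r s, Y.quat (f p) (f q) (f r) (f s) ↔ X.quat p q r s) : Emb X Y where
  toFun := f
  inj := hf
  rel_iff i v := by
    rw [Y.rel_eq_quat, X.rel_eq_quat]
    exact h _ _ _ _

theorem mem_edges_iff_not_side {V : Type} {G : SimpleGraph V} (hG : G.IsTree) {u w x y : V}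
    (huw : G.Adj u w) {p : G.Walk x y} (hp : p.IsPath) :
    s(u, w) ∈ p.edges ↔ ¬ (Side G u w x ↔ Side G u w y) := by
  classical
  rw [← reachable_iff_side hG huw, SimpleGraph.reachable_deleteEdges_iff_exists_walk]
  constructor
  · rintro he ⟨q, hq⟩
    have := congrArg Subtype.val ((hG.isAcyclic.subsingleton_path x y).elim ⟨p, hp⟩ q.toPath)
    simp only at this
    exact hq (q.edges_toPath_subset_edges (this ▸ he))
  · intro h
    by_contra he
    exact h ⟨p, he⟩

namespace FinTree

variable (T : FinTree)

theorem pathRel_iff (x₁ x₂ y₁ y₂ : T.V) :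
    T.pathRel x₁ x₂ y₁ y₂ ↔ [x₁, x₂, y₁, y₂].Nodup ∧ ∃ u w, T.G.Adj u w ∧
      ¬ (Side T.G u w x₁ ↔ Side T.G u w x₂) ∧ ¬ (Side T.G u w y₁ ↔ Side T.G u w y₂) := by
  refine and_congr_right fun _ => ?_
  constructor
  · rintro ⟨p, q, hp, hq, e, hep, heq⟩
    induction e with | h u w =>
    have huw : T.G.Adj u w := p.adj_of_mem_edges hep
    exact ⟨u, w, huw, (mem_edges_iff_not_side T.isTree huw hp).1 hep,
      (mem_edges_iff_not_side T.isTree huw hq).1 heq⟩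
  · rintro ⟨u, w, huw, h1, h2⟩
    obtain ⟨p, hp⟩ := T.isTree.connected.exists_isPath x₁ x₂
    obtain ⟨q, hq⟩ := T.isTree.connected.exists_isPath y₁ y₂
    exact ⟨p, q, hp, hq, s(u, w), (mem_edges_iff_not_side T.isTree huw hp).2 h1,
      (mem_edges_iff_not_side T.isTree huw hq).2 h2⟩

theorem isSplitRel_pathRel : IsSplitRel T.pathRel := by
  refine ⟨{e : T.V × T.V // T.G.Adj e.1 e.2}, fun e => Side T.G e.1.1 e.1.2,
    fun e f p q r s h1 h2 h3 h4 h5 h6 h7 =>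
      side_compat T.isTree e.2 f.2 h1 h2 h3 h4 h5 h6 h7, fun p q r s => ?_⟩
  rw [pathRel_iff]
  refine and_congr_right fun _ => ?_
  simp only [Subtype.exists, Prod.exists, exists_prop]

theorem isSplitRel_leafStruc : IsSplitRel T.leafStruc.quat :=
  T.isSplitRel_pathRel.comap (f := fun v : T.leafStruc.carrier => v.1) Subtype.val_injective

end FinTree

theorem isSplitRel_of_memUpIso {Z : Struc treeSig} (h : MemUpIso TreeClass Z) :
    IsSplitRel Z.quat := by
  have hemb : ∀ {X Y : Struc treeSig} (_ : Emb X Y), IsSplitRel Y.quat → IsSplitRel X.quat := by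
    intro X Y f hY
    have := hY.comap f.inj
    simpa only [f.quat_iff] using this
  obtain ⟨W, hW, f, -⟩ := h
  apply hemb f
  rcases hW with hW | ⟨T, g, -⟩
  · exact ⟨Empty, fun i => i.elim, fun i => i.elim, fun p => (hW.false p).elim⟩
  · exact hemb g T.isSplitRel_leafStruc

/-- Two elements distinguished by three further ones are separated. -/
theorem separated_of_witness {X : Struc treeSig} (hX : MemUpIso TreeClass X) {a b : X.carrier}
    (hab : a ≠ b) {x y z : X.carrier} (hxa : x ≠ a) (hya : y ≠ a) (hza : z ≠ a)
    (hxb : x ≠ b) (hyb : y ≠ b) (hzb : z ≠ b) (h : ¬ (X.quat a y x z ↔ X.quat b y x z)) :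
    Separated TreeClass X a b hab := by
  classical
  intro A hA
  let f : X.carrier → A.Z.carrier := fun v =>
    if h : v = a then A.j₂.toFun ⟨a, hab⟩ else A.j₁.toFun ⟨v, h⟩
  have hf1 : ∀ v : X.carrier, ∀ hv : v ≠ a, f v = A.j₁.toFun ⟨v, hv⟩ := fun v hv => dif_neg hv
  have hf2 : ∀ v : X.carrier, ∀ hv : v ≠ b, f v = A.j₂.toFun ⟨v, hv⟩ := by
    intro v hv
    by_cases hva : v = a
    · subst hva
      exact dif_pos rfl
    · rw [hf1 v hva]
      exact A.comm ⟨v, by simp [hva, hv]⟩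
  have hq1 : ∀ p q r s, p ≠ a → q ≠ a → r ≠ a → s ≠ a →
      (X.quat p q r s ↔ A.Z.quat (f p) (f q) (f r) (f s)) := by
    intro p q r s hp hq hr hs
    rw [hf1 p hp, hf1 q hq, hf1 r hr, hf1 s hs]
    exact ((X.subEmb {a}ᶜ).quat_iff ⟨p, hp⟩ ⟨q, hq⟩ ⟨r, hr⟩ ⟨s, hs⟩).trans
      (A.j₁.quat_iff _ _ _ _).symm
  have hq2 : ∀ p q r s, p ≠ b → q ≠ b → r ≠ b → s ≠ b →
      (X.quat p q r s ↔ A.Z.quat (f p) (f q) (f r) (f s)) := by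
    intro p q r s hp hq hr hs
    rw [hf2 p hp, hf2 q hq, hf2 r hr, hf2 s hs]
    exact ((X.subEmb {b}ᶜ).quat_iff ⟨p, hp⟩ ⟨q, hq⟩ ⟨r, hr⟩ ⟨s, hs⟩).trans
      (A.j₂.quat_iff _ _ _ _).symm
  have hfab : f a ≠ f b := by
    intro he
    apply h
    rw [hq2 _ _ _ _ hab hyb hxb hzb, hq1 _ _ _ _ hab.symm hya hxa hza, he]
  have hinj : Function.Injective f := by
    intro u v huv
    by_cases hu : u ≠ a ∧ v ≠ a
    · rw [hf1 u hu.1, hf1 v hu.2] at huv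
      exact congrArg Subtype.val (A.j₁.inj huv)
    by_cases hv : u ≠ b ∧ v ≠ b
    · rw [hf2 u hv.1, hf2 v hv.2] at huv
      exact congrArg Subtype.val (A.j₂.inj huv)
    grind
  have hsurj : Function.Surjective f := by
    intro w
    rcases A.surj w with ⟨v, rfl⟩ | ⟨v, rfl⟩
    · exact ⟨v.1, hf1 v.1 v.2⟩
    · exact ⟨v.1, hf2 v.1 v.2⟩
  have hS := isSplitRel_of_memUpIso hX
  have hS' := (isSplitRel_of_memUpIso hA).comap hinj
  have hagree : ∀ p q r s, a ∉ [p, q, r, s] ∨ b ∉ [p, q, r, s] →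
      (X.quat p q r s ↔ A.Z.quat (f p) (f q) (f r) (f s)) := by
    rintro p q r s (hm | hm)
    · exact hq1 _ _ _ _ (by grind) (by grind) (by grind) (by grind)
    · exact hq2 _ _ _ _ (by grind) (by grind) (by grind) (by grind)
  have hquat : ∀ p q r s, X.quat p q r s ↔ A.Z.quat (f p) (f q) (f r) (f s) := by
    by_cases ha : X.quat a y x z
    · exact hS.iff_of_agree hS' hab hxb.symm hyb.symm hzb.symm hagree ha (by tauto)
    · exact hS.iff_of_agree hS' hab.symm hxa.symm hya.symm hza.symm
        (fun p q r s e => hagree p q r s e.symm) (by tauto : X.quat b y x z) ha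
  let e := Equiv.ofBijective f ⟨hinj, hsurj⟩
  refine ⟨Emb.ofQuat e.symm e.symm.injective fun p q r s => ?_, e.symm.surjective, ?_, ?_⟩
  · refine (hquat _ _ _ _).trans (iff_of_eq ?_)
    change A.Z.quat (e (e.symm p)) (e (e.symm q)) (e (e.symm r)) (e (e.symm s)) = _
    simp only [e.apply_symm_apply]
  · intro v
    exact e.symm_apply_eq.2 (hf1 v.1 v.2).symm
  · intro v
    exact e.symm_apply_eq.2 (hf2 v.1 v.2).symm

/-- Two elements with the same relations to all further elements are not separated, provided
that deleting one of them stays in the class. -/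
theorem not_separated_of_twins {X : Struc treeSig} (hX : IsSplitRel X.quat) {a b : X.carrier}
    (hab : a ≠ b) (hb : MemUpIso TreeClass (X.restrict {b}ᶜ))
    (h : ∀ x y z, x ≠ a → y ≠ a → z ≠ a → x ≠ b → y ≠ b → z ≠ b →
      (X.quat a x y z ↔ X.quat b x y z)) : ¬ Separated TreeClass X a b hab := by
  classical
  let g : X.carrier → X.carrier := fun v => if v = b then a else v
  have hgb : ∀ v, g v ≠ b := fun v => by
    by_cases hv : v = b <;> simp [g, hv, hab]
  have hg : ∀ p q r s, p ≠ a → q ≠ a → r ≠ a → s ≠ a →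
      (X.quat (g p) (g q) (g r) (g s) ↔ X.quat p q r s) := by
    intro p q r s hp hq hr hs
    have hnd : ∀ {p q r s}, X.quat p q r s → p ≠ q ∧ p ≠ r ∧ p ≠ s ∧ q ≠ r ∧ q ≠ s ∧ r ≠ s := by
      intro p q r s h
      have := hX.nodup h
      simp at this
      tauto
    have hsw := fun p q r s => (hX.perm p q r s).1
    have hfl := fun p q r s => (hX.perm p q r s).2.2
    simp only [g]
    by_cases hpb : p = b <;> by_cases hqb : q = b <;> by_cases hrb : r = b <;>
      by_cases hsb : s = b <;> grind
  intro hsep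
  let j₁ : Emb (X.restrict {a}ᶜ) (X.restrict {b}ᶜ) :=
    Emb.ofQuat (fun v => ⟨g v.1, hgb v.1⟩) (by
      intro u v huv
      have h1 := u.2
      have h2 := v.2
      simp only [Set.mem_compl_iff, Set.mem_singleton_iff] at h1 h2
      have huv : g u.1 = g v.1 := congrArg Subtype.val huv
      apply Subtype.ext
      simp only [g] at huv
      grind) (by
      intro p q r s
      exact ((X.subEmb _).quat_iff _ _ _ _).symm.trans <|
        (hg _ _ _ _ p.2 q.2 r.2 s.2).trans ((X.subEmb _).quat_iff p q r s))
  obtain ⟨f, hf, -, hf2⟩ := hsep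
    { Z := X.restrict {b}ᶜ
      j₁ := j₁
      j₂ := Emb.id _
      comm := fun v => by
        have hv := v.2
        simp only [Set.mem_compl_iff, Set.mem_insert_iff, Set.mem_singleton_iff] at hv
        exact Subtype.ext (if_neg fun h => hv (Or.inr h))
      surj := fun z => Or.inr ⟨z, rfl⟩ } hb
  obtain ⟨z, hz⟩ := hf b
  exact z.2 ((hf2 z).symm.trans hz)

end TreeStructures

section Leaves

theorem side_iff_of_adj_of_ne {W : Type} {G : SimpleGraph W} {x y u w : W} (h : G.Adj x y)
    (hx : u ≠ x) (hy : u ≠ y) : Side G u w x ↔ Side G u w y :=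
  side_iff_of_adj h fun he => by
    rcases Sym2.eq_iff.1 he with ⟨rfl, -⟩ | ⟨-, rfl⟩
    exacts [hx rfl, hy rfl]

variable {V : Type} {G : SimpleGraph V} [Fintype V] [DecidableRel G.Adj]

theorem side_iff_of_leaf_edge (hG : G.IsTree) {b n p q x z : V} (hb : G.degree b ≤ 1)
    (hn : G.Adj b n) (hpq : s(p, q) = s(b, n)) (hx : x ≠ b) (hz : z ≠ b) :
    Side G p q x ↔ Side G p q z := by
  have key : ∀ v, v ≠ b → ¬ Side G n b v := fun v hv h => hv (Side.eq_leaf hG hb hn h)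
  rcases Sym2.eq_iff.1 hpq with ⟨rfl, rfl⟩ | ⟨rfl, rfl⟩
  · rw [← not_iff_not, ← side_swap hG hn, ← side_swap hG hn]
    exact iff_of_false (key x hx) (key z hz)
  · exact iff_of_false (key x hx) (key z hz)

theorem side_iff_of_side_ne {W : Type} {G : SimpleGraph W} (hG : G.IsTree) {m c p q x y z : W}
    (hmc : G.Adj m c) (hpq : G.Adj p q) (hy : Side G m c y) (hx : ¬ Side G m c x)
    (hz : ¬ Side G m c z) (e : Side G p q m ↔ Side G p q c)
    (hne : ¬ (Side G p q m ↔ Side G p q y)) : Side G p q x ↔ Side G p q z := by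
  have hc := side_self (G := G) m c
  have hm := not_side hG hmc
  have compat := @side_compat _ _ hG _ _ _ _ hmc hpq
  by_cases h : Side G p q y
  · have hm' : ¬ Side G p q m := fun h' => hne (iff_of_true h' h)
    have key : ∀ v, ¬ Side G m c v → ¬ Side G p q v := fun v hv hv' =>
      hm' (compat hy h hc (e.not.1 hm') hv hv' hm)
    exact iff_of_false (key x hx) (key z hz)
  · have hm' : Side G p q m := by_contra fun h' => hne (iff_of_false h' h)
    have key : ∀ v, ¬ Side G m c v → Side G p q v := fun v hv =>
      compat hc (e.1 hm') hy h hm hm' hv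
    exact iff_of_true (key x hx) (key z hz)

end Leaves

namespace FinTree

variable {T : FinTree} {a b na nb : T.V}

theorem three_le_degree (hred : T.Reduced) (hleaves : 3 ≤ Nat.card {v : T.V // T.IsLeaf v})
    (ha : T.IsLeaf a) (hna : T.G.Adj a na) : 3 ≤ T.G.degree na := by
  by_contra h
  have h1 : T.G.degree na ≤ 1 := by
    have := hred na
    omega
  have hsub : (Finset.univ : Finset {v : T.V // T.IsLeaf v}) ⊆ {⟨a, ha⟩, ⟨na, h1⟩} := by
    intro v _
    rcases side_or T.isTree na a v.1 with h | h
    · simp [Subtype.ext_iff, Side.eq_leaf T.isTree ha hna h]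
    · simp [Subtype.ext_iff, Side.eq_leaf T.isTree h1 hna.symm h]
  have := (Finset.card_le_card hsub).trans Finset.card_le_two
  rw [Finset.card_univ, ← Nat.card_eq_fintype_card] at this
  omega

theorem exists_witness (hred : T.Reduced) (ha : T.IsLeaf a) (hb : T.IsLeaf b)
    (hna : T.G.Adj a na) (hnb : T.G.Adj b nb) (hda : 3 ≤ T.G.degree na)
    (hdb : 3 ≤ T.G.degree nb) (hne : na ≠ nb) (h : ¬ T.G.Adj na nb ∨ 4 ≤ T.G.degree nb) :
    ∃ x y z, T.IsLeaf x ∧ T.IsLeaf y ∧ T.IsLeaf z ∧ x ≠ a ∧ y ≠ a ∧ z ≠ a ∧ x ≠ b ∧ y ≠ b ∧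
      z ≠ b ∧ T.pathRel a y x z ∧ ¬ T.pathRel b y x z := by
  have hG := T.isTree
  unfold IsLeaf at ha hb ⊢
  have hnab : na ≠ b := by rintro rfl; omega
  have hnba : nb ≠ a := by rintro rfl; omega
  obtain ⟨w, hw, hwnb⟩ := exists_adj_side hG hne.symm
  obtain ⟨n', hn', hn'na⟩ := exists_adj_side hG hne
  have hwa : w ≠ a := by
    rintro rfl
    exact hnba (Side.eq_leaf hG ha hna hwnb)
  have hwb : Side T.G na w b := (side_iff_of_adj_of_ne hnb hnab hne).2 hwnb
  have hn'b : n' ≠ b := by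
    rintro rfl
    exact hnab (Side.eq_leaf hG hb hnb hn'na)
  obtain ⟨x0, hx0, hx0n⟩ := exists_adj_ne_of_card_lt {a, w}
    (Finset.card_le_two.trans_lt hda)
  obtain ⟨y0, hy0, hy0n⟩ := exists_adj_ne_of_card_lt {b, n'}
    (Finset.card_le_two.trans_lt hdb)
  simp only [Finset.mem_insert, Finset.mem_singleton, not_or] at hx0n hy0n
  obtain ⟨x, hxl, hx⟩ := exists_leaf_side hG hx0
  obtain ⟨y, hyl, hy⟩ := exists_leaf_side hG hy0
  have hwa' : ¬ Side T.G na w a := (side_self na a).branch hG hna.symm hw hwa.symm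
  have hwx : ¬ Side T.G na w x := hx.branch hG hx0 hw hx0n.2
  have hxa : x ≠ a := by
    rintro rfl
    exact hx.branch hG hx0 hna.symm hx0n.1 (side_self _ _)
  have hy0na : ¬ Side T.G nb y0 na := hn'na.branch hG hn' hy0 (Ne.symm hy0n.2)
  have hyb : y ≠ b := by
    rintro rfl
    exact hy.branch hG hy0 hnb.symm hy0n.1 (side_self _ _)
  have hy0b : ¬ Side T.G nb y0 b := (side_self nb b).branch hG hnb.symm hy0 (Ne.symm hy0n.1)
  have hy0x : ¬ Side T.G nb y0 x :=
    fun h => hy0na ((hx.nested hx0 (hwnb.branch hG hw hx0 (Ne.symm hx0n.2)) hne.symm).1 h)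
  have hwy : Side T.G na w y := (hy.nested hy0 hy0na hne).2 hwnb
  obtain ⟨z, hzl, hwz, hy0z, hzb⟩ : ∃ z, T.G.degree z ≤ 1 ∧ Side T.G na w z ∧
      ¬ Side T.G nb y0 z ∧ z ≠ b := by
    by_cases hwn : w = nb
    · subst hwn
      obtain ⟨z0, hz0, hz0n⟩ := exists_adj_ne_of_card_lt {na, b, y0}
        (Finset.card_le_three.trans_lt (h.resolve_left (not_not.2 hw)))
      simp only [Finset.mem_insert, Finset.mem_singleton, not_or] at hz0n
      obtain ⟨z, hzl, hz⟩ := exists_leaf_side hG hz0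
      refine ⟨z, hzl, (hz.nested hz0 ?_ hne).2 hwnb, hz.branch hG hz0 hy0 hz0n.2.2, ?_⟩
      · exact (side_self _ _).branch hG hw.symm hz0 (Ne.symm hz0n.1)
      · rintro rfl
        exact hz.branch hG hz0 hnb.symm hz0n.2.1 (side_self _ _)
    · obtain ⟨w2, hw2, hw2nb⟩ := exists_adj_side hG (Ne.symm hwn)
      have hw2na : na ≠ w2 := by
        rintro rfl
        exact (side_swap hG hw nb).1 hw2nb hwnb
      have hdw : 1 < T.G.degree w := by
        by_contra! h
        exact hw2na (eq_of_degree_le_one h hw.symm hw2)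
      obtain ⟨z0, hz0, hz0n⟩ := exists_adj_ne_of_card_lt {na, w2}
        (Finset.card_le_two.trans_lt (by have := hred w; omega : 2 < T.G.degree w))
      simp only [Finset.mem_insert, Finset.mem_singleton, not_or] at hz0n
      obtain ⟨z, hzl, hz⟩ := exists_leaf_side hG hz0
      have hz0nb : ¬ Side T.G w z0 nb := hw2nb.branch hG hw2 hz0 (Ne.symm hz0n.2)
      refine ⟨z, hzl, (hz.nested hz0 ?_ hw.ne).2 (side_self _ _), ?_, ?_⟩
      · exact (side_self _ _).branch hG hw.symm hz0 (Ne.symm hz0n.1)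
      · rw [hz.nested hz0 hz0nb (Ne.symm hwn), ← side_iff_of_adj_of_ne hw hne.symm (Ne.symm hwn)]
        exact hy0na
      · rintro rfl
        refine hz0nb ((side_iff_of_adj_of_ne hnb ?_ hwn).1 hz)
        rintro rfl
        omega
  have hya : y ≠ a := fun h => hwa' (h ▸ hwy)
  have hza : z ≠ a := fun h => hwa' (h ▸ hwz)
  have hxb : x ≠ b := fun h => hwx (h ▸ hwb)
  have hyx : y ≠ x := fun h => hwx (h ▸ hwy)
  have hyz : y ≠ z := fun h => hy0z (h ▸ hy)
  have hxz : x ≠ z := fun h => hwx (h ▸ hwz)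
  refine ⟨x, y, z, hxl, hyl, hzl, hxa, hya, hza, hxb, hyb, hzb, ?_, ?_⟩
  · rw [pathRel_iff]
    exact ⟨by simp [hya.symm, hxa.symm, hza.symm, hyx, hyz, hxz], na, w, hw,
      fun h => hwa' (h.2 hwy), fun h => hwx (h.2 hwz)⟩
  · rw [pathRel_iff]
    rintro ⟨-, p, q, hpq, h1, h2⟩
    have e1 : Side T.G p q b ↔ Side T.G p q nb := side_iff_of_adj hnb fun he =>
      h2 (side_iff_of_leaf_edge hG hb hnb he.symm hxb hzb)
    have e2 : Side T.G p q nb ↔ Side T.G p q y0 := side_iff_of_adj hy0 fun he => by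
      apply h2
      rcases Sym2.eq_iff.1 he with ⟨rfl, rfl⟩ | ⟨rfl, rfl⟩
      · exact iff_of_false hy0x hy0z
      · rw [side_swap hG hy0, side_swap hG hy0]
        exact iff_of_true hy0x hy0z
    exact h2 (side_iff_of_side_ne hG hy0 hpq hy hy0x hy0z e2 fun h => h1 (e1.trans h))

theorem pathRel_of_twins (ha : T.IsLeaf a) (hb : T.IsLeaf b) (hna : T.G.Adj a na)
    (hnb : T.G.Adj b nb) (hda : 1 < T.G.degree na) (hdb : 1 < T.G.degree nb)
    (h : na = nb ∨ T.G.Adj na nb ∧ T.G.degree nb ≤ 3) {x y z : T.V}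
    (hx : T.IsLeaf x) (hy : T.IsLeaf y) (hz : T.IsLeaf z)
    (hxa : x ≠ a) (hya : y ≠ a) (hza : z ≠ a) (hxb : x ≠ b) (hyb : y ≠ b) (hzb : z ≠ b)
    (hR : T.pathRel a x y z) : T.pathRel b x y z := by
  have hG := T.isTree
  rw [pathRel_iff] at hR ⊢
  obtain ⟨hnd, u, w, huw, h1, h2⟩ := hR
  refine ⟨List.nodup_cons.2 ⟨by simp [hxb.symm, hyb.symm, hzb.symm], (List.nodup_cons.1 hnd).2⟩, ?_⟩
  have e1 : Side T.G u w a ↔ Side T.G u w na := side_iff_of_adj hna fun he =>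
    h2 (side_iff_of_leaf_edge hG ha hna he.symm hya hza)
  have e2 : Side T.G u w b ↔ Side T.G u w nb := side_iff_of_adj hnb fun he =>
    h2 (side_iff_of_leaf_edge hG hb hnb he.symm hyb hzb)
  by_cases hs : Side T.G u w na ↔ Side T.G u w nb
  · exact ⟨u, w, huw, fun h => h1 (e1.trans (hs.trans (e2.symm.trans h))), h2⟩
  obtain ⟨hadj, hd3⟩ := h.resolve_left fun h => hs (h ▸ Iff.rfl)
  have key : ¬ (Side T.G na nb a ↔ Side T.G na nb x) ∧
      ¬ (Side T.G na nb y ↔ Side T.G na nb z) := by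
    have he : s(na, nb) = s(u, w) := by
      by_contra he
      exact hs (side_iff_of_adj hadj he)
    rcases Sym2.eq_iff.1 he with ⟨rfl, rfl⟩ | ⟨rfl, rfl⟩
    · exact ⟨h1, h2⟩
    · simp only [side_swap hG hadj, not_iff_not] at h1 h2
      exact ⟨h1, h2⟩
  obtain ⟨k1, k2⟩ := key
  have hnba : nb ≠ a := by
    rintro rfl
    exact absurd ha (by unfold IsLeaf; omega)
  have hnbl : ∀ {t}, T.IsLeaf t → t ≠ nb := by
    rintro t ht rfl
    exact absurd ht (by unfold IsLeaf; omega)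
  have ka : ¬ Side T.G na nb a :=
    (side_self na a).branch hG hna.symm hadj hnba.symm
  have kx : Side T.G na nb x := by_contra fun h => k1 (iff_of_false ka h)
  obtain ⟨v, hv, hvx⟩ := exists_adj_side hG (hnbl hx)
  have hvna : v ≠ na := by
    rintro rfl
    exact (side_swap hG hadj x).1 hvx kx
  have hvb : v ≠ b := by
    rintro rfl
    exact hxb (Side.eq_leaf hG hb hnb hvx)
  have hbna : b ≠ na := by
    rintro rfl
    exact absurd hb (by unfold IsLeaf; omega)
  have kv : ∀ t, T.IsLeaf t → t ≠ b → (Side T.G nb v t ↔ Side T.G na nb t) := by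
    intro t ht htb
    constructor
    · intro h
      by_contra h'
      rw [← side_swap hG hadj] at h'
      exact h.branch hG hv hadj.symm hvna h'
    · intro h
      obtain ⟨v', hv', hvt⟩ := exists_adj_side hG (hnbl ht)
      have hvna' : v' ≠ na := by
        rintro rfl
        exact (side_swap hG hadj t).1 hvt h
      have hvb' : v' ≠ b := by
        rintro rfl
        exact htb (Side.eq_leaf hG hb hnb hvt)
      by_cases hvv : v' = v
      · exact hvv ▸ hvt
      have hsub : ({na, b, v, v'} : Finset T.V) ⊆ T.G.neighborFinset nb := by
        intro t
        simp only [Finset.mem_insert, Finset.mem_singleton, SimpleGraph.mem_neighborFinset]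
        rintro (rfl | rfl | rfl | rfl)
        exacts [hadj.symm, hnb.symm, hv, hv']
      have hcard := Finset.card_le_card hsub
      have h4 : ({na, b, v, v'} : Finset T.V).card = 4 := by
        simp [hbna.symm, hvna.symm, hvna'.symm, hvb.symm, hvb'.symm, Ne.symm hvv]
      rw [SimpleGraph.card_neighborFinset_eq_degree] at hcard
      omega
  have kb : ¬ Side T.G nb v b := (side_self nb b).branch hG hnb.symm hv hvb.symm
  refine ⟨nb, v, hv, fun h => kb (h.2 hvx), ?_⟩
  rwa [kv y hy hyb, kv z hz hzb]

end FinTree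

theorem degree_le_one_iff {V : Type} {G : SimpleGraph V} [Fintype V] [DecidableRel G.Adj] {v : V} :
    G.degree v ≤ 1 ↔ ∀ p q, G.Adj v p → G.Adj v q → p = q := by
  rw [← SimpleGraph.card_neighborFinset_eq_degree, Finset.card_le_one]
  simp only [SimpleGraph.mem_neighborFinset]
  exact ⟨fun h p q hp hq => h p hp q hq, fun h p hp q hq => h p q hp hq⟩

namespace FinTree

theorem pathRel_map {T T' : FinTree} (f : T'.G →g T.G) (hf : Function.Injective f)
    (p q r s : T'.V) : T.pathRel (f p) (f q) (f r) (f s) ↔ T'.pathRel p q r s := by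
  have path_unique : ∀ {x y : T.V} {w w' : T.G.Walk x y}, w.IsPath → w'.IsPath → w = w' :=
    fun hw hw' => congrArg Subtype.val
      ((T.isTree.isAcyclic.subsingleton_path _ _).elim ⟨_, hw⟩ ⟨_, hw'⟩)
  refine and_congr ?_ ⟨?_, ?_⟩
  · exact List.nodup_map_iff (l := [p, q, r, s]) hf
  · rintro ⟨u, w, hu, hw, e, heu, hew⟩
    obtain ⟨u', hu'⟩ := T'.isTree.connected.exists_isPath p q
    obtain ⟨w', hw'⟩ := T'.isTree.connected.exists_isPath r s
    rw [path_unique hu (hu'.map hf), SimpleGraph.Walk.edges_map, List.mem_map] at heu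
    rw [path_unique hw (hw'.map hf), SimpleGraph.Walk.edges_map, List.mem_map] at hew
    obtain ⟨e', heu', rfl⟩ := heu
    obtain ⟨e'', hew', he⟩ := hew
    obtain rfl := Sym2.map.injective hf he
    exact ⟨u', w', hu', hw', _, heu', hew'⟩
  · rintro ⟨u, w, hu, hw, e, heu, hew⟩
    refine ⟨u.map f, w.map f, hu.map hf, hw.map hf, e.map f, ?_, ?_⟩
    · rw [SimpleGraph.Walk.edges_map]
      exact List.mem_map_of_mem heu
    · rw [SimpleGraph.Walk.edges_map]
      exact List.mem_map_of_mem hew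

/-- The tree obtained by deleting a leaf. -/
noncomputable def removeLeaf (T : FinTree) (b : T.V) (hb : T.G.degree b = 1) : FinTree where
  V := {v : T.V // v ∈ ({b} : Set T.V)ᶜ}
  fin := Fintype.ofFinite _
  dec := Classical.decEq _
  G := T.G.induce {b}ᶜ
  adjDec := Classical.decRel _
  isTree := ⟨T.isTree.connected.induce_compl_singleton_of_degree_eq_one hb,
    T.isTree.isAcyclic.induce _⟩

theorem isLeaf_removeLeaf {T : FinTree} {b nb : T.V} (hb : T.G.degree b = 1)
    (hnb : T.G.Adj b nb) (h3 : 3 ≤ T.G.degree nb) (v : (T.removeLeaf b hb).V) :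
    (T.removeLeaf b hb).IsLeaf v ↔ T.IsLeaf v.1 := by
  unfold IsLeaf
  rw [degree_le_one_iff, degree_le_one_iff]
  constructor
  · intro h p q hp hq
    have h' : ∀ p q, p ≠ b → q ≠ b → T.G.Adj v.1 p → T.G.Adj v.1 q → p = q :=
      fun p q hpb hqb hp hq => congrArg Subtype.val (h ⟨p, hpb⟩ ⟨q, hqb⟩ hp hq)
    by_cases hv : v.1 = nb
    · rw [hv] at h'
      obtain ⟨r, hr, hr'⟩ := exists_adj_ne_of_card_lt {b} (by simp; omega : _ < T.G.degree nb)
      obtain ⟨s, hs, hs'⟩ := exists_adj_ne_of_card_lt {b, r} (Finset.card_le_two.trans_lt h3)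
      simp only [Finset.mem_insert, Finset.mem_singleton, not_or] at hr' hs'
      exact absurd (h' s r hs'.1 hr' hs hr) hs'.2
    · have hne : ∀ p, T.G.Adj v.1 p → p ≠ b := by
        rintro p hp rfl
        exact hv (eq_of_degree_le_one hb.le hp.symm hnb)
      exact h' p q (hne p hp) (hne q hq) hp hq
  · intro h p q hp hq
    exact Subtype.ext (h p.1 q.1 hp hq)

theorem memUpIso_restrict_compl {T : FinTree} {b : T.leafStruc.carrier} {nb : T.V}
    (hnb : T.G.Adj b.1 nb) (h3 : 3 ≤ T.G.degree nb) :
    MemUpIso TreeClass (T.leafStruc.restrict {b}ᶜ) := by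
  have hb : T.G.degree b.1 = 1 :=
    le_antisymm b.2 ((T.G.degree_pos_iff_exists_adj _).2 ⟨nb, hnb⟩)
  have hleaf := isLeaf_removeLeaf hb hnb h3
  let f : (T.leafStruc.restrict {b}ᶜ).carrier → (T.removeLeaf b.1 hb).leafStruc.carrier :=
    fun v => ⟨⟨v.1.1, fun h => v.2 (Subtype.ext h)⟩, (hleaf _).2 v.1.2⟩
  refine ⟨_, leafStruc_mem_treeClass (T.removeLeaf b.1 hb), Emb.ofQuat f ?_ ?_, ?_⟩
  · intro u v h
    exact Subtype.ext (Subtype.ext (congrArg (fun x => x.1.1) h))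
  · intro p q r s
    exact (pathRel_map (T' := T.removeLeaf b.1 hb) (SimpleGraph.Embedding.induce _).toHom
      Subtype.val_injective _ _ _ _).symm
  · intro v
    exact ⟨⟨⟨v.1.1, (hleaf _).1 v.2⟩, fun h => v.1.2 (congrArg Subtype.val h)⟩, rfl⟩

end FinTree

end Paper

namespace Paper

/-- **Separated leaves in a tree** (Proposition 3.3).  Let `T` be a reduced tree with at
least three leaves, and let `a ≠ b` be leaves of `T`, with unique neighbours `na`, `nb`
respectively.  Then `a` and `b` are separated in the leaf structure `L(T)` relative to the
Fraïssé class `𝔗` of tree structures if and only if either (a) `na` and `nb` are distinct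
and not adjacent, or (b) `na` and `nb` are distinct and at least one of them has valence
`≥ 4`. -/
theorem separated_iff_in_tree (T : FinTree) (hred : T.Reduced)
    (hleaves : 3 ≤ Nat.card {v : T.V // T.IsLeaf v})
    (a b : T.leafStruc.carrier) (hab : a ≠ b)
    (na nb : T.V) (hna : T.G.Adj a.1 na) (hnb : T.G.Adj b.1 nb) :
    Separated TreeClass T.leafStruc a b hab ↔
      ((na ≠ nb ∧ ¬ T.G.Adj na nb) ∨
       (na ≠ nb ∧ (4 ≤ T.G.degree na ∨ 4 ≤ T.G.degree nb))) := by
  have hda := FinTree.three_le_degree hred hleaves a.2 hna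
  have hdb := FinTree.three_le_degree hred hleaves b.2 hnb
  have hX : MemUpIso TreeClass T.leafStruc := memUpIso_of_mem (leafStruc_mem_treeClass T)
  constructor
  · intro hsep
    by_contra! hcon
    refine not_separated_of_twins T.isSplitRel_leafStruc hab
      (FinTree.memUpIso_restrict_compl hnb hdb) (fun x y z hxa hya hza hxb hyb hzb => ?_) hsep
    replace hxa := Subtype.coe_ne_coe.2 hxa
    replace hya := Subtype.coe_ne_coe.2 hya
    replace hza := Subtype.coe_ne_coe.2 hza
    replace hxb := Subtype.coe_ne_coe.2 hxb
    replace hyb := Subtype.coe_ne_coe.2 hyb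
    replace hzb := Subtype.coe_ne_coe.2 hzb
    constructor
    · refine FinTree.pathRel_of_twins a.2 b.2 hna hnb (by omega) (by omega) ?_ x.2 y.2 z.2
        hxa hya hza hxb hyb hzb
      exact or_iff_not_imp_left.2 fun hne => ⟨hcon.1 hne, by have := hcon.2 hne; omega⟩
    · refine FinTree.pathRel_of_twins b.2 a.2 hnb hna (by omega) (by omega) ?_ x.2 y.2 z.2
        hxb hyb hzb hxa hya hza
      exact or_iff_not_imp_left.2 fun hne =>
        ⟨(hcon.1 (Ne.symm hne)).symm, by have := hcon.2 (Ne.symm hne); omega⟩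
  · intro h
    obtain ⟨hne, h⟩ : na ≠ nb ∧ ((¬ T.G.Adj na nb ∨ 4 ≤ T.G.degree nb) ∨
        (¬ T.G.Adj nb na ∨ 4 ≤ T.G.degree na)) := by tauto
    rcases h with h | h
    · obtain ⟨x, y, z, hx, hy, hz, hxa, hya, hza, hxb, hyb, hzb, h1, h2⟩ :=
        FinTree.exists_witness hred a.2 b.2 hna hnb hda hdb hne h
      exact separated_of_witness hX hab (x := ⟨x, hx⟩) (y := ⟨y, hy⟩) (z := ⟨z, hz⟩)
        (Subtype.coe_ne_coe.1 hxa) (Subtype.coe_ne_coe.1 hya) (Subtype.coe_ne_coe.1 hza)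
        (Subtype.coe_ne_coe.1 hxb) (Subtype.coe_ne_coe.1 hyb) (Subtype.coe_ne_coe.1 hzb)
        fun h => h2 (h.1 h1)
    · obtain ⟨x, y, z, hx, hy, hz, hxb, hyb, hzb, hxa, hya, hza, h1, h2⟩ :=
        FinTree.exists_witness hred b.2 a.2 hnb hna hdb hda hne.symm h
      exact separated_of_witness hX hab (x := ⟨x, hx⟩) (y := ⟨y, hy⟩) (z := ⟨z, hz⟩)
        (Subtype.coe_ne_coe.1 hxa) (Subtype.coe_ne_coe.1 hya) (Subtype.coe_ne_coe.1 hza)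
        (Subtype.coe_ne_coe.1 hxb) (Subtype.coe_ne_coe.1 hyb) (Subtype.coe_ne_coe.1 hzb)
        fun h => h2 (h.2 h1)

end Paper
end

section
/- A marked tree structure (X, a) (with X ∈ 𝔗 and a ∈ X) is minimal, relative to the Fraïssé class 𝔗, if and only if it is isomorphic as a marked structure to the marked leaf structure of one of the marked trees X_m (for some m ≥ 1), Y, or Z. -/
/-! # The marked trees `X_m`, `Y`, `Z` (via their leaf structures) -/

namespace Paper

/-- The leaf structure of the star tree `X_m` (one central node adjacent to `m` leaves; for
`m ≤ 2` the tree with `m` vertices): `m` leaves and the empty quaternary relation. -/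
def XmStruc (m : ℕ) : Struc treeSig where
  carrier := Fin m
  rel := fun _ _ => False

/-- `(X, a)` is isomorphic as a marked structure to the marked leaf structure of the star
`X_m` (marked at one of its leaves). -/
def IsMarkedXm (m : ℕ) (hm : 0 < m) (X : Struc treeSig) (a : X.carrier) : Prop :=
  ∃ f : Emb (XmStruc m) X, f.IsIso ∧ f.toFun ⟨0, hm⟩ = a

/-- The leaf structure of the tree `Y`: two adjacent valence-3 nodes, each additionally
adjacent to two leaves.  Leaves `0,1` hang off the first node and `2,3` off the second;
`R(x₁,x₂;y₁,y₂)` holds iff all four are distinct and both paths cross the middle edge. -/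
def YStruc : Struc treeSig where
  carrier := Fin 4
  rel := fun _ v => Function.Injective v ∧
    ((((v 0 : Fin 4) : ℕ) < 2 ↔ ¬ (((v 1 : Fin 4) : ℕ) < 2)) ∧
     ((((v 2 : Fin 4) : ℕ) < 2 ↔ ¬ (((v 3 : Fin 4) : ℕ) < 2))))

/-- `(X, a)` is isomorphic as a marked structure to the marked leaf structure of `Y`. -/
def IsMarkedY (X : Struc treeSig) (a : X.carrier) : Prop :=
  ∃ f : Emb YStruc X, f.IsIso ∧ f.toFun (0 : Fin 4) = a

/-- `x` is a leaf adjacent to the node `A` of the tree `Z` below. -/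
def ZsideA (x : Fin 5) : Prop := (x : ℕ) < 2

/-- `x` is a leaf adjacent to the node `C` of the tree `Z` below. -/
def ZsideC (x : Fin 5) : Prop := 2 ≤ (x : ℕ) ∧ (x : ℕ) < 4

/-- The leaf structure of the tree `Z`: three valence-3 nodes forming a path `A–B–C`, with
leaves `0,1` adjacent to `A`, leaves `2,3` adjacent to `C` and leaf `4` adjacent to `B`.
`R(x₁,x₂;y₁,y₂)` holds iff all four are distinct and both paths cross the edge `A–B`, or
both paths cross the edge `B–C`. -/
def ZStruc : Struc treeSig where
  carrier := Fin 5
  rel := fun _ v => Function.Injective v ∧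
    (((ZsideA (v 0) ↔ ¬ ZsideA (v 1)) ∧ (ZsideA (v 2) ↔ ¬ ZsideA (v 3))) ∨
     ((ZsideC (v 0) ↔ ¬ ZsideC (v 1)) ∧ (ZsideC (v 2) ↔ ¬ ZsideC (v 3))))

/-- `(X, a)` is isomorphic as a marked structure to the marked leaf structure of `Z`
(marked at the leaf adjacent to the middle node). -/
def IsMarkedZ (X : Struc treeSig) (a : X.carrier) : Prop :=
  ∃ f : Emb ZStruc X, f.IsIso ∧ f.toFun (4 : Fin 5) = a

end Paper

namespace Paper

/-! # Quartet systems -/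

/-- A quartet system: `Q a b c d` reads `ab|cd`, i.e. some split of the underlying set has
`a, b` on one side and `c, d` on the other. -/
structure IsQuartet {α : Type*} (Q : α → α → α → α → Prop) : Prop where
  nodup : ∀ {a b c d}, Q a b c d → [a, b, c, d].Nodup
  swap : ∀ {a b c d}, Q a b c d → Q b a c d
  flip : ∀ {a b c d}, Q a b c d → Q c d a b
  thin : ∀ {a b c d}, Q a b c d → ¬ Q a c b d
  trans : ∀ {a b c d e}, Q a b c d → Q a b c e → d ≠ e → Q a b d e
  sat : ∀ {a b c d} (e), Q a b c d → e ∉ [a, b, c, d] →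
    (Q a e c d ∧ Q b e c d) ∨ (Q a b c e ∧ Q a b d e)

/-- The quartet relation of a family of splits. -/
def splitQuartet {α : Type*} (𝒮 : Set (Set α)) (a b c d : α) : Prop :=
  [a, b, c, d].Nodup ∧ ∃ S ∈ 𝒮, (a ∈ S ↔ b ∈ S) ∧ (c ∈ S ↔ d ∈ S) ∧ ¬ (a ∈ S ↔ c ∈ S)

/-- A family of splits is compatible if for any two of them, one of the four intersections
of their sides is empty. -/
def SplitsCompatible {α : Type*} (𝒮 : Set (Set α)) : Prop :=
  ∀ S ∈ 𝒮, ∀ S' ∈ 𝒮, ∃ P P' : Prop, ∀ x, (x ∈ S ↔ P) ∨ (x ∈ S' ↔ P')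

theorem SplitsCompatible.isQuartet {α : Type*} {𝒮 : Set (Set α)} (h𝒮 : SplitsCompatible 𝒮) :
    IsQuartet (splitQuartet 𝒮) where
  nodup h := h.1
  swap := by
    rintro a b c d ⟨hn, S, hS, h⟩
    exact ⟨by simp at hn ⊢; tauto, S, hS, by tauto⟩
  flip := by
    rintro a b c d ⟨hn, S, hS, h⟩
    refine ⟨?_, S, hS, by tauto⟩
    simp only [List.nodup_cons, List.mem_cons, List.not_mem_nil, or_false, not_or,
      not_false_eq_true, List.nodup_nil, and_true] at hn ⊢
    grind
  thin := by
    rintro a b c d ⟨hn, S, hS, h⟩ ⟨-, S', hS', h'⟩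
    obtain ⟨P, P', hP⟩ := h𝒮 S hS S' hS'
    have := hP a; have := hP b; have := hP c; have := hP d
    grind
  trans := by
    rintro a b c d e ⟨hn, S, hS, h⟩ ⟨hn', S', hS', h'⟩ hde
    refine ⟨by simp at hn hn' ⊢; grind, ?_⟩
    obtain ⟨P, P', hP⟩ := h𝒮 S hS S' hS'
    have := hP a; have := hP c; have := hP d; have := hP e
    by_cases h1 : d ∈ S ↔ e ∈ S
    · exact ⟨S, hS, by grind⟩
    · exact ⟨S', hS', by grind⟩
  sat := by
    rintro a b c d e ⟨hn, S, hS, h⟩ he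
    simp at hn he
    by_cases h1 : e ∈ S ↔ a ∈ S
    · exact Or.inl ⟨⟨by simp; grind, S, hS, by grind⟩, ⟨by simp; grind, S, hS, by grind⟩⟩
    · exact Or.inr ⟨⟨by simp; grind, S, hS, by grind⟩, ⟨by simp; grind, S, hS, by grind⟩⟩

theorem IsQuartet.comap {α β : Type*} {Q : β → β → β → β → Prop} (hQ : IsQuartet Q)
    {f : α → β} (hf : Function.Injective f) :
    IsQuartet fun a b c d => Q (f a) (f b) (f c) (f d) where
  nodup h := by simpa [hf.eq_iff] using hQ.nodup h
  swap h := hQ.swap h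
  flip h := hQ.flip h
  thin h := hQ.thin h
  trans h h' hne := hQ.trans h h' (hf.ne hne)
  sat e h he := hQ.sat (f e) h (by simpa [hf.eq_iff] using he)

/-! # The splits of a tree -/

section Side

open SimpleGraph

variable {V : Type*} {G : SimpleGraph V}

/-- The vertices on the side of `u` after removal of the edge `uv`. -/
def side (G : SimpleGraph V) (u v : V) : Set V :=
  {x | (G.deleteEdges {s(u, v)}).Reachable x u}

theorem mem_side_or_reachable (hG : G.Connected) (u v x : V) :
    x ∈ side G u v ∨ (G.deleteEdges {s(u, v)}).Reachable x v := by
  obtain ⟨p⟩ := hG.preconnected x u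
  induction p with
  | nil => exact Or.inl (Reachable.refl _)
  | @cons x y w hxy p ih =>
    by_cases he : s(x, y) = s(w, v)
    · rcases Sym2.eq_iff.mp he with ⟨rfl, rfl⟩ | ⟨rfl, rfl⟩
      · exact Or.inl (Reachable.refl _)
      · exact Or.inr (Reachable.refl _)
    · have hr : (G.deleteEdges {s(w, v)}).Reachable x y :=
        Adj.reachable (by simp [deleteEdges_adj, hxy, he])
      exact ih.imp hr.trans hr.trans

theorem reachable_deleteEdge_iff_side (hG : G.Connected) (u v x y : V) :
    (G.deleteEdges {s(u, v)}).Reachable x y ↔ (x ∈ side G u v ↔ y ∈ side G u v) := by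
  refine ⟨fun h => ⟨h.symm.trans, h.trans⟩, fun h => ?_⟩
  by_cases hx : x ∈ side G u v
  · exact Reachable.trans hx (Reachable.symm (h.mp hx))
  · have h1 := (mem_side_or_reachable hG u v x).resolve_left hx
    have h2 := (mem_side_or_reachable hG u v y).resolve_left (mt h.mpr hx)
    exact h1.trans h2.symm

theorem mem_edges_iff_side (hG : G.IsTree) (u v : V) {x y : V} {p : G.Walk x y}
    (hp : p.IsPath) : s(u, v) ∈ p.edges ↔ ¬ (x ∈ side G u v ↔ y ∈ side G u v) := by
  classical
  rw [← reachable_deleteEdge_iff_side hG.connected, iff_not_comm]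
  refine ⟨?_, fun h => ⟨p.toDeleteEdge _ h⟩⟩
  rintro ⟨q⟩ he
  have hq := (q.bypass_isPath).mapLe (G.deleteEdges_le {s(u, v)})
  have heq := (hG.existsUnique_path x y).unique hp hq
  rw [heq, Walk.edges_mapLe_eq_edges] at he
  simpa using q.bypass.edges_subset_edgeSet he

/-- The family of all splits given by the edges of a graph. -/
def edgeSplits (G : SimpleGraph V) : Set (Set V) := {S | ∃ u v, G.Adj u v ∧ S = side G u v}

theorem edgeSplits_compatible (hG : G.Connected) : SplitsCompatible (edgeSplits G) := by
  classical
  rintro _ ⟨u, v, huv, rfl⟩ _ ⟨u', v', huv', rfl⟩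
  by_cases he : s(u', v') = s(u, v)
  · rcases Sym2.eq_iff.mp he with ⟨rfl, rfl⟩ | ⟨rfl, rfl⟩
    · exact ⟨True, False, fun x => by tauto⟩
    · refine ⟨True, True, fun x => ?_⟩
      simp only [iff_true]
      refine (mem_side_or_reachable hG v' u' x).imp_right fun h => ?_
      rwa [side, Sym2.eq_swap]
  · refine ⟨u' ∈ side G u v, u ∈ side G u' v', fun x => ?_⟩
    rw [← reachable_deleteEdge_iff_side hG, ← reachable_deleteEdge_iff_side hG]
    by_contra! hx
    have key : ∀ t, (G.deleteEdges {s(u, v)}).Reachable x t →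
        (G.deleteEdges {s(u', v')}).Reachable x t := by
      rintro t ⟨p⟩
      refine ⟨(p.mapLe (G.deleteEdges_le _)).toDeleteEdge _ fun h => ?_⟩
      rw [Walk.edges_mapLe_eq_edges] at h
      exact hx.1 ⟨p.takeUntil u' (p.fst_mem_support_of_mem_edges h)⟩
    have huv₂ : (G.deleteEdges {s(u', v')}).Reachable v u :=
      Adj.reachable (by simp [deleteEdges_adj, huv.symm, Sym2.eq_swap (a := v), Ne.symm he])
    rcases mem_side_or_reachable hG u v x with h | h
    · exact hx.2 (key u h)
    · exact hx.2 ((key v h).trans huv₂)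

end Side

theorem FinTree.pathRel_iff_s4 (T : FinTree) (x y z w : T.V) :
    T.pathRel x y z w ↔ [x, y, z, w].Nodup ∧ ∃ u v, T.G.Adj u v ∧
      ¬ (x ∈ side T.G u v ↔ y ∈ side T.G u v) ∧ ¬ (z ∈ side T.G u v ↔ w ∈ side T.G u v) := by
  refine and_congr_right fun _ => ⟨?_, ?_⟩
  · rintro ⟨p, q, hp, hq, ⟨u, v⟩, hep, heq⟩
    exact ⟨u, v, p.adj_of_mem_edges hep, (mem_edges_iff_side T.isTree u v hp).mp hep,
      (mem_edges_iff_side T.isTree u v hq).mp heq⟩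
  · rintro ⟨u, v, -, h1, h2⟩
    obtain ⟨p, hp, -⟩ := T.isTree.existsUnique_path x y
    obtain ⟨q, hq, -⟩ := T.isTree.existsUnique_path z w
    exact ⟨p, q, hp, hq, s(u, v), (mem_edges_iff_side T.isTree u v hp).mpr h1,
      (mem_edges_iff_side T.isTree u v hq).mpr h2⟩

/-- The quaternary relation of a structure for the tree signature. -/
def treeRel (X : Struc treeSig) (x y z w : X.carrier) : Prop := X.rel () ![x, y, z, w]

theorem rel_iff_treeRel (X : Struc treeSig) (v : Fin 4 → X.carrier) :
    X.rel () v ↔ treeRel X (v 0) (v 1) (v 2) (v 3) := by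
  have : v = ![v 0, v 1, v 2, v 3] := by ext i; fin_cases i <;> rfl
  rw [treeRel, ← this]

theorem Emb.treeRel_iff {X Y : Struc treeSig} (f : Emb X Y) (x y z w : X.carrier) :
    treeRel Y (f.toFun x) (f.toFun y) (f.toFun z) (f.toFun w) ↔ treeRel X x y z w := by
  rw [treeRel.eq_def X, ← f.rel_iff]
  exact (rel_iff_treeRel Y fun j => f.toFun (![x, y, z, w] j)).symm

/-- An injection preserving and reflecting the quaternary relation is an embedding. -/
def Emb.ofTreeRel {X Y : Struc treeSig} (f : X.carrier → Y.carrier)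
    (hf : Function.Injective f)
    (h : ∀ x y z w, treeRel Y (f x) (f y) (f z) (f w) ↔ treeRel X x y z w) : Emb X Y where
  toFun := f
  inj := hf
  rel_iff := fun _ v => (rel_iff_treeRel Y _).trans ((h _ _ _ _).trans (rel_iff_treeRel X v).symm)

/-- The quartet `ab|cd` expressed through the quaternary relation. -/
def quart (X : Struc treeSig) (a b c d : X.carrier) : Prop :=
  treeRel X a c b d ∧ treeRel X a d b c

/-- The quaternary relation comes from a quartet system. -/
structure IsQuartetStruc (X : Struc treeSig) : Prop where
  isQuartet : IsQuartet (quart X)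
  rel_iff : ∀ x y z w, treeRel X x y z w ↔ quart X x z y w ∨ quart X x w y z

theorem IsQuartetStruc.of_isQuartet {X : Struc treeSig}
    {Q : X.carrier → X.carrier → X.carrier → X.carrier → Prop} (hQ : IsQuartet Q)
    (h : ∀ x y z w, treeRel X x y z w ↔ Q x z y w ∨ Q x w y z) : IsQuartetStruc X := by
  have key : quart X = Q := by
    funext a b c d
    have h1 := @hQ.thin a b d c
    have h2 := @hQ.thin a d c b
    have h3 := @hQ.thin a b c d
    have s : ∀ {a b c d}, Q a b c d → Q a b d c := fun h => hQ.flip (hQ.swap (hQ.flip h))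
    have s1 := @s a b c d
    have s2 := @s a b d c
    have s3 := @s a d c b
    have s4 := @s a d b c
    have s5 := @s a c b d
    have s6 := @s a c d b
    simp only [quart, h, eq_iff_iff]
    tauto
  subst key
  exact ⟨hQ, h⟩

theorem FinTree.isQuartetStruc_leafStruc (T : FinTree) : IsQuartetStruc T.leafStruc := by
  refine .of_isQuartet ((edgeSplits_compatible T.isTree.connected).isQuartet.comap
    Subtype.val_injective) fun x y z w => ?_
  change T.pathRel x.1 y.1 z.1 w.1 ↔ _
  rw [T.pathRel_iff_s4]
  constructor
  · rintro ⟨hn, u, v, huv, h1, h2⟩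
    by_cases h3 : x.1 ∈ side T.G u v ↔ z.1 ∈ side T.G u v
    · exact Or.inl ⟨by simp at hn ⊢; grind, _, ⟨u, v, huv, rfl⟩, by tauto⟩
    · exact Or.inr ⟨by simp at hn ⊢; grind, _, ⟨u, v, huv, rfl⟩, by tauto⟩
  · rintro (⟨hn, _, ⟨u, v, huv, rfl⟩, h⟩ | ⟨hn, _, ⟨u, v, huv, rfl⟩, h⟩)
    · exact ⟨by simp at hn ⊢; grind, u, v, huv, by tauto⟩
    · exact ⟨by simp at hn ⊢; grind, u, v, huv, by tauto⟩

theorem IsQuartetStruc.of_emb {X Y : Struc treeSig} (hY : IsQuartetStruc Y) (f : Emb X Y) :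
    IsQuartetStruc X := by
  refine .of_isQuartet (hY.isQuartet.comap f.inj) fun x y z w => ?_
  rw [← f.treeRel_iff, hY.rel_iff]

theorem isQuartetStruc_of_memUpIso {X : Struc treeSig} (hX : MemUpIso TreeClass X) :
    IsQuartetStruc X := by
  obtain ⟨W, hW | ⟨T, g, -⟩, f, -⟩ := hX
  · have : IsEmpty X.carrier := ⟨fun x => hW.elim (f.toFun x)⟩
    exact .of_isQuartet (Q := fun _ _ _ _ => False)
      ⟨fun h => h.elim, fun h => h.elim, fun h => h.elim, fun h => h.elim, fun h => h.elim,
        fun _ h => h.elim⟩ fun x => isEmptyElim x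
  · exact T.isQuartetStruc_leafStruc.of_emb (g.comp f)

/-! # Quartet systems agreeing away from a pair of points -/

namespace IsQuartet

variable {α : Type*} {Q Q' : α → α → α → α → Prop}

theorem swap_right (hQ : IsQuartet Q) {a b c d : α} (h : Q a b c d) : Q a b d c :=
  hQ.flip (hQ.swap (hQ.flip h))

theorem thin' (hQ : IsQuartet Q) {a b c d : α} (h : Q a b c d) : ¬ Q a d b c :=
  hQ.thin (hQ.swap_right h)

theorem ne (hQ : IsQuartet Q) {a b c d : α} (h : Q a b c d) :
    a ≠ b ∧ a ≠ c ∧ a ≠ d ∧ b ≠ c ∧ b ≠ d ∧ c ≠ d := by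
  have := hQ.nodup h
  simp at this
  tauto

/-- If `b, y` lie on one side of a split with `p, r` on the other, then `b` may be replaced
by `y` in a quartet `pq|rb`. -/
theorem exchange (hQ : IsQuartet Q) {p q r b y : α} (h : Q p q r b) (h' : Q p r b y) :
    Q p q r y := by
  have hn := hQ.ne h
  have hn' := hQ.ne h'
  have hyq : y ≠ q := by
    rintro rfl
    exact hQ.thin h (hQ.swap_right h')
  rcases hQ.sat y h (by simp; tauto) with ⟨h1, -⟩ | ⟨h1, -⟩
  · exact (hQ.thin (hQ.swap_right h') h1).elim
  · exact h1

theorem cross_of_not (hQ : IsQuartet Q) {a b x y z : α} (h : Q a x y z) (hb : ¬ Q b x y z)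
    (hab : b ≠ a) (hbx : b ∉ [x, y, z]) : Q a x b y := by
  rcases hQ.sat b h (by simp at hbx ⊢; tauto) with ⟨-, h1⟩ | ⟨h1, -⟩
  · exact (hb (hQ.swap h1)).elim
  · exact hQ.swap_right h1

/-- Two relations agree on all quadruples not containing both `a` and `b`. -/
def AgreeOff (a b : α) (Q Q' : α → α → α → α → Prop) : Prop :=
  ∀ p q r s, a ∉ [p, q, r, s] ∨ b ∉ [p, q, r, s] → (Q p q r s ↔ Q' p q r s)

theorem AgreeOff.symm {a b : α} (h : AgreeOff a b Q Q') : AgreeOff b a Q Q' :=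
  fun p q r s hn => h p q r s hn.symm

theorem AgreeOff.symm' {a b : α} (h : AgreeOff a b Q Q') : AgreeOff a b Q' Q :=
  fun p q r s hn => (h p q r s hn).symm

theorem imp_of_same_side (hQ : IsQuartet Q) (hQ' : IsQuartet Q') {a b u v y : α}
    (hag : AgreeOff a b Q Q') (hu : Q a u b y) (hu' : Q' a u b y) (hv : Q a v b y)
    (hv' : Q' a v b y) :
    (Q a b u v → Q' a b u v) ∧ (Q a u b v → Q' a u b v) := by
  have hun := hQ.ne hu
  have hvn := hQ.ne hv
  refine ⟨fun h => ?_, fun h => ?_⟩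
  · have h1 := hQ.exchange (hQ.flip h) (hQ.swap hu)
    have h2 := (hag u v a y (by simp; tauto)).mp h1
    exact hQ'.flip (hQ'.exchange h2 (hQ'.swap_right (hQ'.swap hu')))
  · have h1 := hQ.exchange (hQ.swap_right h) hv
    have h2 := (hag a u v y (by simp; tauto)).mp h1
    exact hQ'.swap_right (hQ'.exchange h2 (hQ'.swap_right hv'))

theorem side_dichotomy (hQ : IsQuartet Q) (hQ' : IsQuartet Q') {a b x y u : α}
    (hag : AgreeOff a b Q Q') (h : Q a x b y) (h' : Q' a x b y) (hua : u ≠ a) (hub : u ≠ b) :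
    (Q a u b y ∧ Q' a u b y) ∨ (Q a x b u ∧ Q' a x b u) := by
  have hn := hQ.ne h
  by_cases hux : u = x
  · subst hux
    exact Or.inl ⟨h, h'⟩
  by_cases huy : u = y
  · subst huy
    exact Or.inr ⟨h, h'⟩
  rcases hQ.sat u h (by simp; tauto) with ⟨h1, h2⟩ | ⟨h1, h2⟩
  · refine Or.inl ⟨h1, ?_⟩
    have h3 := (hag x u b y (by simp; tauto)).mp h2
    exact hQ'.flip (hQ'.trans (hQ'.flip (hQ'.swap h')) (hQ'.flip h3) hua.symm)
  · refine Or.inr ⟨h1, ?_⟩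
    have h3 := (hag a x y u (by simp; tauto)).mp h2
    exact hQ'.trans (hQ'.swap_right h') h3 hub.symm

theorem cross_of_opposite_sides (hQ : IsQuartet Q) (hQ' : IsQuartet Q') {a b u v y : α}
    (hag : AgreeOff a b Q Q') (hu : Q a u b y) (hu' : Q' a u b y)
    (hv : ¬ (Q a v b y ∧ Q' a v b y)) (hva : v ≠ a) (hvb : v ≠ b) : Q a u b v := by
  have hun := hQ.ne hu
  by_cases hvy : v = y
  · subst hvy
    exact hu
  by_cases hvu : v = u
  · subst hvu
    exact (hv ⟨hu, hu'⟩).elim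
  rcases hQ.sat v hu (by simp; tauto) with ⟨h1, h2⟩ | ⟨h1, -⟩
  · have h3 := (hag u v b y (by simp; tauto)).mp h2
    exact (hv ⟨h1, hQ'.flip (hQ'.trans (hQ'.flip (hQ'.swap hu')) (hQ'.flip h3) hva.symm)⟩).elim
  · exact h1

theorem imp_of_agreeOff_of_pair (hQ : IsQuartet Q) (hQ' : IsQuartet Q') {a b x y u v : α}
    (hag : AgreeOff a b Q Q') (h : Q a x b y) (h' : Q' a x b y) (hua : u ≠ a) (hub : u ≠ b)
    (hva : v ≠ a) (hvb : v ≠ b) :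
    (Q a b u v → Q' a b u v) ∧ (Q a u b v → Q' a u b v) := by
  by_cases hu : Q a u b y ∧ Q' a u b y <;> by_cases hv : Q a v b y ∧ Q' a v b y
  · exact hQ.imp_of_same_side hQ' hag hu.1 hu.2 hv.1 hv.2
  · have h1 := hQ.cross_of_opposite_sides hQ' hag hu.1 hu.2 hv hva hvb
    have h2 := hQ'.cross_of_opposite_sides hQ hag.symm' hu.2 hu.1 (mt And.symm hv) hva hvb
    exact ⟨fun h3 => (hQ.thin h1 h3).elim, fun _ => h2⟩
  · have h1 := hQ.cross_of_opposite_sides hQ' hag hv.1 hv.2 hu hua hub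
    exact ⟨fun h3 => (hQ.thin h1 (hQ.swap_right h3)).elim,
      fun h3 => (hQ.thin' h1 (hQ.swap_right h3)).elim⟩
  · have hu2 := (hQ.side_dichotomy hQ' hag h h' hua hub).resolve_left hu
    have hv2 := (hQ.side_dichotomy hQ' hag h h' hva hvb).resolve_left hv
    have key := hQ.imp_of_same_side hQ' hag.symm (hQ.flip hv2.1) (hQ'.flip hv2.2)
      (hQ.flip hu2.1) (hQ'.flip hu2.2)
    exact ⟨fun h3 => hQ'.swap (hQ'.swap_right (key.1 (hQ.swap (hQ.swap_right h3)))),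
      fun h3 => hQ'.flip (key.2 (hQ.flip h3))⟩

theorem imp_of_agreeOff (hQ : IsQuartet Q) (hQ' : IsQuartet Q') {a b x y : α}
    (hag : AgreeOff a b Q Q') (h : Q a x b y) (h' : Q' a x b y) {p q r s : α}
    (hp : Q p q r s) : Q' p q r s := by
  have key : ∀ {q r s}, Q a q r s → Q' a q r s := by
    intro q r s hq
    have hn := hQ.ne hq
    have pair := fun {u v} => @imp_of_agreeOff_of_pair _ _ _ hQ hQ' a b x y u v hag h h'
    by_cases hb : b ∈ [a, q, r, s]
    · have hba : b ≠ a := fun e => (hQ.ne h).2.1 e.symm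
      simp only [List.mem_cons, hba, List.not_mem_nil, or_false, false_or] at hb
      rcases hb with rfl | rfl | rfl
      · exact (pair (by tauto) (by tauto) (by tauto) (by tauto)).1 hq
      · exact (pair (by tauto) (by tauto) (by tauto) (by tauto)).2 hq
      · exact hQ'.swap_right
          ((pair (by tauto) (by tauto) (by tauto) (by tauto)).2 (hQ.swap_right hq))
    · exact (hag _ _ _ _ (Or.inr hb)).mp hq
  by_cases ha : a ∈ [p, q, r, s]
  · simp only [List.mem_cons, List.not_mem_nil, or_false] at ha
    rcases ha with rfl | rfl | rfl | rfl
    · exact key hp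
    · exact hQ'.swap (key (hQ.swap hp))
    · exact hQ'.flip (key (hQ.flip hp))
    · exact hQ'.flip (hQ'.swap (key (hQ.swap (hQ.flip hp))))
  · exact (hag _ _ _ _ (Or.inl ha)).mp hp

end IsQuartet

/-! # Separation of non-twins -/

/-- `a` and `b` are twins if they are in the same position relative to the other points. -/
def Twins {α : Type*} (Q : α → α → α → α → Prop) (a b : α) : Prop :=
  ∀ x y z, a ∉ [x, y, z] → b ∉ [x, y, z] → (Q a x y z ↔ Q b x y z)

theorem separated_of_not_twins {X : Struc treeSig} (hX : IsQuartetStruc X) {a b : X.carrier}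
    (hab : a ≠ b) (h : ¬ Twins (quart X) a b) : Separated TreeClass X a b hab := by
  classical
  intro A hA
  have hZ := isQuartetStruc_of_memUpIso hA
  let f : X.carrier → A.Z.carrier := fun x =>
    if hx : x = a then A.j₂.toFun ⟨a, by simpa using hab⟩ else A.j₁.toFun ⟨x, by simpa using hx⟩
  have f1 : ∀ x (hx : x ∈ ({a} : Set X.carrier)ᶜ), f x = A.j₁.toFun ⟨x, hx⟩ := by
    intro x hx
    exact dif_neg (by simpa using hx)
  have f2 : ∀ x (hx : x ∈ ({b} : Set X.carrier)ᶜ), f x = A.j₂.toFun ⟨x, hx⟩ := by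
    intro x hx
    by_cases hxa : x = a
    · subst hxa
      exact dif_pos rfl
    · rw [f1 x (by simpa using hxa)]
      exact A.comm ⟨x, by simp at hx ⊢; tauto⟩
  have r1 : ∀ p q r s, a ∉ [p, q, r, s] →
      (treeRel A.Z (f p) (f q) (f r) (f s) ↔ treeRel X p q r s) := by
    intro p q r s hn
    simp only [List.mem_cons, List.not_mem_nil, or_false, not_or, eq_comm (a := a)] at hn
    rw [f1 p hn.1, f1 q hn.2.1, f1 r hn.2.2.1, f1 s hn.2.2.2]
    let x (u : X.carrier) (hu : ¬ u = a) :
        (X.restrict {a}ᶜ).carrier := ⟨u, hu⟩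
    exact (A.j₁.treeRel_iff (x p hn.1) (x q hn.2.1) (x r hn.2.2.1) (x s hn.2.2.2)).trans
      ((X.subEmb _).treeRel_iff (x p hn.1) (x q hn.2.1) (x r hn.2.2.1) (x s hn.2.2.2)).symm
  have r2 : ∀ p q r s, b ∉ [p, q, r, s] →
      (treeRel A.Z (f p) (f q) (f r) (f s) ↔ treeRel X p q r s) := by
    intro p q r s hn
    simp only [List.mem_cons, List.not_mem_nil, or_false, not_or, eq_comm (a := b)] at hn
    rw [f2 p hn.1, f2 q hn.2.1, f2 r hn.2.2.1, f2 s hn.2.2.2]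
    let x (u : X.carrier) (hu : ¬ u = b) :
        (X.restrict {b}ᶜ).carrier := ⟨u, hu⟩
    exact (A.j₂.treeRel_iff (x p hn.1) (x q hn.2.1) (x r hn.2.2.1) (x s hn.2.2.2)).trans
      ((X.subEmb _).treeRel_iff (x p hn.1) (x q hn.2.1) (x r hn.2.2.1) (x s hn.2.2.2)).symm
  have hag : IsQuartet.AgreeOff a b (quart X)
      (fun p q r s => quart A.Z (f p) (f q) (f r) (f s)) := by
    rintro p q r s (hn | hn)
    · exact (and_congr (r1 _ _ _ _ (by simp at hn ⊢; tauto))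
        (r1 _ _ _ _ (by simp at hn ⊢; tauto))).symm
    · exact (and_congr (r2 _ _ _ _ (by simp at hn ⊢; tauto))
        (r2 _ _ _ _ (by simp at hn ⊢; tauto))).symm
  have hfab : f a ≠ f b := by
    intro hf
    refine h fun x y z ha hb => ?_
    rw [hag a x y z (Or.inr (by simp at hb ⊢; tauto)),
      hag b x y z (Or.inl (by simp at ha ⊢; tauto))]
    simp only [hf]
  have hinj : Function.Injective f := by
    intro x y hxy
    by_cases hx : x = a <;> by_cases hy : y = a
    · rw [hx, hy]
    · subst hx
      by_cases hyb : y = b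
      · exact (hfab (hyb ▸ hxy)).elim
      · rw [f2 x (by simpa using hab), f2 y (by simpa using hyb)] at hxy
        exact congrArg Subtype.val (A.j₂.inj hxy)
    · subst hy
      by_cases hxb : x = b
      · exact (hfab (hxb ▸ hxy.symm)).elim
      · rw [f2 x (by simpa using hxb), f2 y (by simpa using hab)] at hxy
        exact congrArg Subtype.val (A.j₂.inj hxy)
    · rw [f1 x (by simpa using hx), f1 y (by simpa using hy)] at hxy
      exact congrArg Subtype.val (A.j₁.inj hxy)
  have hsurj : Function.Surjective f := by
    intro z
    rcases A.surj z with ⟨⟨x, hx⟩, rfl⟩ | ⟨⟨x, hx⟩, rfl⟩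
    · exact ⟨x, f1 x hx⟩
    · exact ⟨x, f2 x hx⟩
  have hQ := hX.isQuartet
  have hQ' := hZ.isQuartet.comap hinj
  have hcross : ∃ x y, quart X a x b y ∧ quart A.Z (f a) (f x) (f b) (f y) := by
    simp only [Twins, not_forall, exists_prop] at h
    obtain ⟨x, y, z, ha, hb, hne⟩ := h
    have ea := hag a x y z (Or.inr (by simp at hb ⊢; tauto))
    have eb := hag b x y z (Or.inl (by simp at ha ⊢; tauto))
    by_cases hq : quart X a x y z
    · have hq' : ¬ quart X b x y z := fun h' => hne (by tauto)
      exact ⟨x, y, hQ.cross_of_not hq hq' hab.symm hb,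
        hQ'.cross_of_not (ea.mp hq) (mt eb.mpr hq') hab.symm hb⟩
    · have hq' : quart X b x y z := by tauto
      exact ⟨y, x, hQ.flip (hQ.cross_of_not hq' hq hab ha),
        hQ'.flip (hQ'.cross_of_not (eb.mp hq') (mt ea.mpr hq) hab ha)⟩
  obtain ⟨x, y, hc, hc'⟩ := hcross
  have hquart : ∀ p q r s, quart A.Z (f p) (f q) (f r) (f s) ↔ quart X p q r s :=
    fun p q r s => ⟨hQ'.imp_of_agreeOff hQ hag.symm' hc' hc, hQ.imp_of_agreeOff hQ' hag hc hc'⟩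
  let e := Equiv.ofBijective f ⟨hinj, hsurj⟩
  refine ⟨Emb.ofTreeRel e.symm e.symm.injective fun p q r s => ?_, e.symm.surjective, ?_, ?_⟩
  · obtain ⟨p, rfl⟩ := e.surjective p
    obtain ⟨q, rfl⟩ := e.surjective q
    obtain ⟨r, rfl⟩ := e.surjective r
    obtain ⟨s, rfl⟩ := e.surjective s
    simp only [Equiv.symm_apply_apply]
    change treeRel X p q r s ↔ treeRel A.Z (f p) (f q) (f r) (f s)
    rw [hX.rel_iff, hZ.rel_iff, hquart, hquart]
  · rintro ⟨x, hx⟩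
    exact e.symm_apply_eq.mpr (f1 x hx).symm
  · rintro ⟨x, hx⟩
    exact e.symm_apply_eq.mpr (f2 x hx).symm

/-! # Collapsing two points -/

/-- A map identifying `a` with `b`, and otherwise an isomorphism, onto a tree structure
shows that `a` and `b` are not separated. -/
theorem not_separated_of_collapse {X W : Struc treeSig} (hW : W ∈ TreeClass)
    {a b : X.carrier} (hab : a ≠ b) (g : X.carrier → W.carrier) (hg : g a = g b)
    (hsurj : Function.Surjective g)
    (hinj : ∀ x y, g x = g y → x ≠ y → (x = a ∨ y = a) ∧ (x = b ∨ y = b))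
    (hrel : ∀ p q r s, a ∉ [p, q, r, s] ∨ b ∉ [p, q, r, s] →
      (treeRel W (g p) (g q) (g r) (g s) ↔ treeRel X p q r s)) :
    ¬ Separated TreeClass X a b hab := by
  intro hsep
  let j (c : X.carrier) (hc : c = a ∨ c = b) : Emb (X.restrict {c}ᶜ) W :=
    Emb.ofTreeRel (fun x => g x.1)
      (by
        rintro ⟨x, hx⟩ ⟨y, hy⟩ hxy
        simp only [Set.mem_compl_iff, Set.mem_singleton_iff] at hx hy
        by_contra hne
        have := hinj x y hxy (fun h => hne (Subtype.ext h))
        rcases hc with rfl | rfl <;> tauto)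
      (by
        intro p q r s
        have hmem : c ∉ [p.1, q.1, r.1, s.1] := by
          have h (t : (X.restrict {c}ᶜ).carrier) : c ≠ t.1 := fun h => t.2 h.symm
          simp [h]
        exact (hrel p.1 q.1 r.1 s.1 (by rcases hc with rfl | rfl <;> tauto)).trans
          ((X.subEmb {c}ᶜ).treeRel_iff p q r s))
  obtain ⟨f, -, h1, h2⟩ := hsep
    { Z := W, j₁ := j a (Or.inl rfl), j₂ := j b (Or.inr rfl), comm := fun _ => rfl,
      surj := fun z => by
        obtain ⟨x, rfl⟩ := hsurj z
        by_cases hx : x = a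
        · exact Or.inr ⟨⟨x, by simpa [hx] using hab⟩, rfl⟩
        · exact Or.inl ⟨⟨x, by simpa using hx⟩, rfl⟩ }
    (memUpIso_of_mem hW)
  have e1 : f.toFun (g b) = b := h1 ⟨b, by simpa using hab.symm⟩
  have e2 : f.toFun (g a) = a := h2 ⟨a, by simpa using hab⟩
  exact hab (e2.symm.trans ((congrArg f.toFun hg).trans e1))

/-! # Stars -/

theorem FinTree.mem_treeClass {X : Struc treeSig} (T : FinTree) (f : X.carrier → T.V)
    (hf : Function.Injective f) (hrange : ∀ v, T.IsLeaf v ↔ v ∈ Set.range f)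
    (h : ∀ x y z w, T.pathRel (f x) (f y) (f z) (f w) ↔ treeRel X x y z w) :
    X ∈ TreeClass := by
  refine Or.inr ⟨T, Emb.ofTreeRel (Y := T.leafStruc)
    (fun x => ⟨f x, (hrange _).mpr ⟨x, rfl⟩⟩) (fun x y hxy => hf (congrArg Subtype.val hxy)) h, ?_⟩
  rintro ⟨v, hv⟩
  obtain ⟨x, rfl⟩ := (hrange v).mp hv
  exact ⟨x, rfl⟩

theorem mem_side_iff_of_adj {V : Type*} {G : SimpleGraph V} (hG : G.Connected) {u v x y : V}
    (hxy : G.Adj x y) (hne : s(x, y) ≠ s(u, v)) : x ∈ side G u v ↔ y ∈ side G u v :=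
  (reachable_deleteEdge_iff_side hG u v x y).mp
    (SimpleGraph.Adj.reachable (by simp [SimpleGraph.deleteEdges_adj, hxy, hne]))

theorem not_mem_side_iff_of_adj {V : Type*} {G : SimpleGraph V} (hG : G.IsTree) {u v : V}
    (huv : G.Adj u v) : ¬ (u ∈ side G u v ↔ v ∈ side G u v) :=
  (mem_edges_iff_side hG u v (p := huv.toWalk) (by simp [huv.ne])).mp (by simp)

theorem mem_treeClass_of_forall_not_treeRel (X : Struc treeSig)
    (hX : ∀ x y z w, ¬ treeRel X x y z w) : X ∈ TreeClass := by
  classical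
  have := Fintype.ofFinite X.carrier
  rcases isEmpty_or_nonempty X.carrier with hE | ⟨⟨o⟩⟩
  · exact Or.inl hE
  by_cases hcard : Fintype.card X.carrier ≤ 2
  · refine FinTree.mem_treeClass ⟨X.carrier, .starGraph o, SimpleGraph.isTree_starGraph o⟩ id
      Function.injective_id (fun v => ?_) fun x y z w => ?_
    · simp only [FinTree.IsLeaf, Set.range_id, Set.mem_univ, iff_true]
      have := SimpleGraph.degree_lt_card_verts (G := SimpleGraph.starGraph o) v
      omega
    · refine iff_of_false (fun h => ?_) (hX _ _ _ _)
      have := h.1.length_le_card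
      simp at this
      omega
  · have htree := SimpleGraph.isTree_starGraph (none : Option X.carrier)
    refine FinTree.mem_treeClass ⟨Option X.carrier, .starGraph none, htree⟩ some
      (Option.some_injective _) (fun v => ?_) fun x y z w => ?_
    · rcases v with _ | x
      · simp only [FinTree.IsLeaf, Set.mem_range, reduceCtorEq, exists_false, iff_false]
        have h : (SimpleGraph.starGraph (none : Option X.carrier)).degree none
            = Fintype.card X.carrier := by
          rw [(SimpleGraph.degree_eq_card_sub_one _ none).mpr SimpleGraph.isUniversal_starGraph_self]
          simp
        omega
      · simp only [FinTree.IsLeaf, Set.mem_range, Option.some.injEq, exists_eq, iff_true]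
        exact (SimpleGraph.degree_starGraph_of_ne_center (by simp)).le
    · refine iff_of_false (fun h => ?_) (hX _ _ _ _)
      rw [FinTree.pathRel_iff_s4] at h
      obtain ⟨hn, u, v, -, h1, h2⟩ := h
      have key : ∀ t : X.carrier, s(u, v) = s(some t, none) ∨
          (some t ∈ side (.starGraph none) u v ↔ none ∈ side (.starGraph none) u v) := by
        intro t
        refine or_iff_not_imp_left.mpr fun hne =>
          mem_side_iff_of_adj htree.connected (by simp) (Ne.symm hne)
      have hxy : s(u, v) = s(some x, none) ∨ s(u, v) = s(some y, none) := by
        have := key x; have := key y; tauto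
      have hzw : s(u, v) = s(some z, none) ∨ s(u, v) = s(some w, none) := by
        have := key z; have := key w; tauto
      simp at hn
      rcases hxy with hxy | hxy <;> rcases hzw with hzw | hzw <;>
        · rw [hxy] at hzw
          simp at hzw
          tauto

theorem not_separated_of_forall_not_treeRel {X : Struc treeSig} {a b : X.carrier} (hab : a ≠ b)
    (h : ∀ p q r s, a ∉ [p, q, r, s] ∨ b ∉ [p, q, r, s] → ¬ treeRel X p q r s) :
    ¬ Separated TreeClass X a b hab := by
  classical
  let W : Struc treeSig := { carrier := {x : X.carrier // x ≠ b}, rel := fun _ _ => False }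
  refine not_separated_of_collapse (W := W)
    (mem_treeClass_of_forall_not_treeRel W fun _ _ _ _ => id) hab
    (fun x => if hx : x = b then ⟨a, hab⟩ else ⟨x, hx⟩) (by simp [hab])
    (fun z => ⟨z.1, dif_neg z.2⟩) (fun x y hxy hne => ?_)
    fun p q r s hn => iff_of_false id (h p q r s hn)
  by_cases hx : x = b <;> by_cases hy : y = b <;> simp [hx, hy] at hxy <;> grind

/-! # The structures `Y` and `Z` -/

theorem treeRel_YStruc (x y z w : Fin 4) : treeRel YStruc x y z w ↔ [x, y, z, w].Nodup ∧
    ((x : ℕ) < 2 ↔ ¬ (y : ℕ) < 2) ∧ ((z : ℕ) < 2 ↔ ¬ (w : ℕ) < 2) := by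
  have h : Function.Injective ![x, y, z, w] ↔ [x, y, z, w].Nodup := by
    rw [← List.nodup_ofFn]; simp
  rw [← h]
  rfl

theorem treeRel_ZStruc (x y z w : Fin 5) : treeRel ZStruc x y z w ↔ [x, y, z, w].Nodup ∧
    ((((x : ℕ) < 2 ↔ ¬ (y : ℕ) < 2) ∧ ((z : ℕ) < 2 ↔ ¬ (w : ℕ) < 2)) ∨
      (((2 ≤ (x : ℕ) ∧ (x : ℕ) < 4) ↔ ¬ (2 ≤ (y : ℕ) ∧ (y : ℕ) < 4)) ∧
        ((2 ≤ (z : ℕ) ∧ (z : ℕ) < 4) ↔ ¬ (2 ≤ (w : ℕ) ∧ (w : ℕ) < 4)))) := by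
  have h : Function.Injective ![x, y, z, w] ↔ [x, y, z, w].Nodup := by
    rw [← List.nodup_ofFn]; simp
  rw [← h]
  rfl

/-- The tree `Y`: the leaves `0, 1` are adjacent to the node `4`, the leaves `2, 3` to the
node `5`, and the two nodes are adjacent. -/
def yGraph : SimpleGraph (Fin 6) where
  Adj x y := (x, y) ∈ [(0, 4), (1, 4), (2, 5), (3, 5), (4, 5), (4, 0), (4, 1), (5, 2), (5, 3), (5, 4)]
  symm := ⟨by decide⟩
  loopless := ⟨by decide⟩

instance : DecidableRel yGraph.Adj := fun x y => by unfold yGraph; infer_instance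

theorem isTree_yGraph : yGraph.IsTree := by
  rw [SimpleGraph.isTree_iff_connected_and_card]
  constructor
  · rw [SimpleGraph.connected_iff_exists_forall_reachable]
    have h45 : yGraph.Reachable 4 5 := SimpleGraph.Adj.reachable (by decide)
    refine ⟨4, fun w => ?_⟩
    fin_cases w
    · exact SimpleGraph.Adj.reachable (by decide)
    · exact SimpleGraph.Adj.reachable (by decide)
    · exact h45.trans (SimpleGraph.Adj.reachable (by decide))
    · exact h45.trans (SimpleGraph.Adj.reachable (by decide))
    · exact .refl _
    · exact h45
  · rw [Nat.card_eq_fintype_card, Nat.card_eq_fintype_card, ← SimpleGraph.edgeFinset_card]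
    decide +kernel

theorem YStruc_mem_treeClass : YStruc ∈ TreeClass := by
  have hc := isTree_yGraph.connected
  refine FinTree.mem_treeClass (X := YStruc) ⟨Fin 6, yGraph, isTree_yGraph⟩
    (Fin.castLE (by norm_num)) (Fin.castLE_injective _) ?_ fun (x y z w : Fin 4) => ?_
  · simp only [FinTree.IsLeaf]
    change ∀ v : Fin 6, yGraph.degree v ≤ 1 ↔ ∃ y : Fin 4, Fin.castLE _ y = v
    decide +kernel
  · rw [FinTree.pathRel_iff_s4, treeRel_YStruc]
    simp only
    rw [← List.nodup_map_iff (Fin.castLE_injective (show 4 ≤ 6 by norm_num)) (l := [x, y, z, w])]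
    refine and_congr_right fun hn => ⟨?_, fun h => ⟨4, 5, by decide, ?_⟩⟩
    · rintro ⟨u, v, -, h1, h2⟩
      classical
      have e (t t' : Fin 6) (h : yGraph.Adj t t') (hne : s(t, t') ≠ s(u, v)) :
          t ∈ side yGraph u v ↔ t' ∈ side yGraph u v := mem_side_iff_of_adj hc h hne
      have hcases : ((0 : Fin 6) ∈ side yGraph u v ↔ (1 : Fin 6) ∈ side yGraph u v) ∨
          ((2 : Fin 6) ∈ side yGraph u v ↔ (3 : Fin 6) ∈ side yGraph u v) := by
        by_cases huv : s(u, v) ∈ [s(0, 4), s((1 : Fin 6), 4)]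
        · refine Or.inr ((e 2 5 (by decide) ?_).trans (e 3 5 (by decide) ?_).symm) <;>
          · intro h
            rw [← h] at huv
            revert huv
            decide
        · simp only [List.mem_cons, List.not_mem_nil, or_false, not_or] at huv
          exact Or.inl ((e 0 4 (by decide) (Ne.symm huv.1)).trans
            (e 1 4 (by decide) (Ne.symm huv.2)).symm)
      let c (t : Fin 4) : Bool := decide (Fin.castLE (show 4 ≤ 6 by norm_num) t ∈ side yGraph u v)
      have key : ∀ c : Fin 4 → Bool, (c 0 = c 1 ∨ c 2 = c 3) → ∀ x y z w : Fin 4,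
          [x, y, z, w].Nodup → c x ≠ c y → c z ≠ c w →
          ((x : ℕ) < 2 ↔ ¬ (y : ℕ) < 2) ∧ ((z : ℕ) < 2 ↔ ¬ (w : ℕ) < 2) := by
        decide +kernel
      refine key c ?_ x y z w (List.Nodup.of_map _ hn) ?_ ?_
      · simp only [c, decide_eq_decide]
        exact hcases
      · simpa only [c, ne_eq, decide_eq_decide] using h1
      · simpa only [c, ne_eq, decide_eq_decide] using h2
    · have h45 := not_mem_side_iff_of_adj isTree_yGraph (u := 4) (v := 5) (by decide)
      have key : ∀ t : Fin 4, Fin.castLE (show 4 ≤ 6 by norm_num) t ∈ side yGraph 4 5 ↔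
          ((t : ℕ) < 2 ↔ 4 ∈ side yGraph 4 5) := by
        have e : ∀ t t' : Fin 6, yGraph.Adj t t' → s(t, t') ≠ s(4, 5) →
            (t ∈ side yGraph 4 5 ↔ t' ∈ side yGraph 4 5) :=
          fun t t' => mem_side_iff_of_adj hc
        have e0 := e 0 4 (by decide) (by decide)
        have e1 := e 1 4 (by decide) (by decide)
        have e2 := e 2 5 (by decide) (by decide)
        have e3 := e 3 5 (by decide) (by decide)
        intro t
        fin_cases t <;> simp <;> tauto
      rw [key, key, key, key]
      tauto

/-! # The marked trees `X_m`, `Y`, `Z` are minimal -/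

theorem MinimalMarked.of_forall_not_treeRel {X : Struc treeSig} {a : X.carrier}
    (h : ∀ b ≠ a, ∀ p q r s, a ∉ [p, q, r, s] ∨ b ∉ [p, q, r, s] → ¬ treeRel X p q r s) :
    MinimalMarked TreeClass X a :=
  fun b ⟨hab, hsep⟩ => not_separated_of_forall_not_treeRel hab (h b hab.symm) hsep

theorem IsMarkedXm.minimalMarked {m : ℕ} {hm : 0 < m} {X : Struc treeSig} {a : X.carrier}
    (h : IsMarkedXm m hm X a) : MinimalMarked TreeClass X a := by
  obtain ⟨f, hf, -⟩ := h
  refine .of_forall_not_treeRel fun b _ p q r s _ => ?_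
  obtain ⟨p, rfl⟩ := hf p
  obtain ⟨q, rfl⟩ := hf q
  obtain ⟨r, rfl⟩ := hf r
  obtain ⟨s, rfl⟩ := hf s
  exact (f.treeRel_iff p q r s).not.mpr id

theorem IsMarkedY.minimalMarked {X : Struc treeSig} {a : X.carrier} (h : IsMarkedY X a) :
    MinimalMarked TreeClass X a := by
  obtain ⟨f, hf, -⟩ := h
  refine .of_forall_not_treeRel fun b _ p q r s hn hrel => ?_
  obtain ⟨p, rfl⟩ := hf p
  obtain ⟨q, rfl⟩ := hf q
  obtain ⟨r, rfl⟩ := hf r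
  obtain ⟨s, rfl⟩ := hf s
  have hnodup := ((treeRel_YStruc p q r s).mp ((f.treeRel_iff p q r s).mp hrel)).1
  have hall : ∀ p q r s : Fin 4, [p, q, r, s].Nodup → ∀ x, x ∈ [p, q, r, s] := by
    decide +kernel
  have hmem (x : X.carrier) : x ∈ [f.toFun p, f.toFun q, f.toFun r, f.toFun s] := by
    obtain ⟨x, rfl⟩ := hf x
    exact List.mem_map_of_mem (f := f.toFun) (hall p q r s hnodup x)
  exact hn.elim (· (hmem a)) (· (hmem b))

/-- The collapse of the leaf `4` of `Z` onto the leaf `b`. -/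
def collapseZ (b : Fin 4) (x : Fin 5) : Fin 4 := if h : (x : ℕ) < 4 then ⟨x, h⟩ else b

theorem treeRel_collapseZ (b : Fin 4) (p q r s : Fin 5)
    (h : 4 ∉ [p, q, r, s] ∨ b.castSucc ∉ [p, q, r, s]) :
    treeRel YStruc (collapseZ b p) (collapseZ b q) (collapseZ b r) (collapseZ b s) ↔
      treeRel ZStruc p q r s := by
  rw [treeRel_YStruc, treeRel_ZStruc]
  revert b p q r s
  set_option synthInstance.maxSize 1000 in
  decide +kernel

theorem IsMarkedZ.minimalMarked {X : Struc treeSig} {a : X.carrier} (h : IsMarkedZ X a) :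
    MinimalMarked TreeClass X a := by
  obtain ⟨f, hf, rfl⟩ := h
  rintro b ⟨hab, hsep⟩
  let e : Fin 5 ≃ X.carrier := Equiv.ofBijective f.toFun ⟨f.inj, hf⟩
  obtain ⟨b, rfl⟩ := e.surjective b
  change e 4 ≠ e b at hab
  change Separated TreeClass X (e 4) (e b) hab at hsep
  have hb4 : ∀ b : Fin 5, 4 ≠ b → ∃ c : Fin 4, b = c.castSucc := by decide
  obtain ⟨c, rfl⟩ := hb4 b fun h => hab (congrArg e h)
  have hcollapse : ∀ c, collapseZ c 4 = collapseZ c c.castSucc := by decide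
  have hsurj : ∀ c x, collapseZ c x.castSucc = x := by decide
  have hinj : ∀ c x y, collapseZ c x = collapseZ c y → x ≠ y →
      (x = 4 ∨ y = 4) ∧ (x = c.castSucc ∨ y = c.castSucc) := by decide +kernel
  refine not_separated_of_collapse (W := YStruc) YStruc_mem_treeClass hab
    (fun x => collapseZ c (e.symm x)) ?_ (fun z => ⟨e z.castSucc, ?_⟩) (fun x y h hne => ?_)
    (fun p q r s hn => ?_) hsep
  · exact (congrArg (collapseZ c) (e.symm_apply_apply _)).trans
      ((hcollapse c).trans (congrArg (collapseZ c) (e.symm_apply_apply _)).symm)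
  · exact (congrArg (collapseZ c) (e.symm_apply_apply _)).trans (hsurj c z)
  · have := hinj c _ _ h (e.symm.injective.ne hne)
    simpa only [Equiv.symm_apply_eq] using this
  · obtain ⟨p, rfl⟩ := e.surjective p
    obtain ⟨q, rfl⟩ := e.surjective q
    obtain ⟨r, rfl⟩ := e.surjective r
    obtain ⟨s, rfl⟩ := e.surjective s
    simp only [Equiv.symm_apply_apply]
    have hmem (t : Fin 5) : e t ∈ [e p, e q, e r, e s] ↔ t ∈ [p, q, r, s] := by
      simp [e.injective.eq_iff]
    rw [hmem, hmem] at hn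
    exact (treeRel_collapseZ c p q r s hn).trans (f.treeRel_iff p q r s).symm

/-! # Recognizing `X_m`, `Y`, `Z` -/

theorem isMarkedXm_of_forall_not_treeRel {X : Struc treeSig} (hX : ∀ x y z w, ¬ treeRel X x y z w)
    (a : X.carrier) : ∃ (m : ℕ) (hm : 0 < m), IsMarkedXm m hm X a := by
  classical
  have := Fintype.ofFinite X.carrier
  have hm : 0 < Fintype.card X.carrier := Fintype.card_pos_iff.mpr ⟨a⟩
  let e := (Fintype.equivFin X.carrier).symm
  let e' := e.trans (Equiv.swap (e ⟨0, hm⟩) a)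
  exact ⟨_, hm, Emb.ofTreeRel (X := XmStruc _) e' e'.injective
    (fun x y z w => iff_of_false (hX _ _ _ _) id), e'.surjective, Equiv.swap_apply_left _ _⟩

/-- The eight ways of writing the quartet `ab|cd`. -/
def quartetOrbit {α : Type*} (a b c d : α) : List (α × α × α × α) :=
  [(a, b, c, d), (b, a, c, d), (a, b, d, c), (b, a, d, c),
    (c, d, a, b), (d, c, a, b), (c, d, b, a), (d, c, b, a)]

theorem IsQuartet.of_mem_quartetOrbit {α : Type*} {Q : α → α → α → α → Prop} (hQ : IsQuartet Q)
    {a b c d x y z w : α} (h : Q a b c d) (hx : (x, y, z, w) ∈ quartetOrbit a b c d) :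
    Q x y z w := by
  have h1 := hQ.swap h
  have h2 := hQ.flip h
  have h3 := hQ.flip h1
  have h4 := hQ.swap h2
  have h5 := hQ.swap h3
  have h6 := hQ.flip h4
  have h7 := hQ.flip h5
  simp only [quartetOrbit, List.mem_cons, List.not_mem_nil, or_false, Prod.mk.injEq] at hx
  rcases hx with h | h | h | h | h | h | h | h <;> (obtain ⟨rfl, rfl, rfl, rfl⟩ := h; assumption)

/-- The quaternary relation comes from quartets, and each four-element subset has one. -/
structure IsResolved (W : Struc treeSig) : Prop where
  rel_iff : ∀ x y z w, treeRel W x y z w ↔ quart W x z y w ∨ quart W x w y z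
  exists_quart : ∀ x y z w, [x, y, z, w].Nodup →
    quart W x y z w ∨ quart W x z y w ∨ quart W x w y z

theorem isResolved_YStruc : IsResolved YStruc := by
  constructor
  · have h : ∀ x y z w : Fin 4, treeRel YStruc x y z w ↔
        quart YStruc x z y w ∨ quart YStruc x w y z := by
      simp only [quart, treeRel_YStruc]
      decide +kernel
    exact h
  · have h : ∀ x y z w : Fin 4, [x, y, z, w].Nodup →
        quart YStruc x y z w ∨ quart YStruc x z y w ∨ quart YStruc x w y z := by
      simp only [quart, treeRel_YStruc]
      decide +kernel
    exact h

theorem isResolved_ZStruc : IsResolved ZStruc := by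
  constructor
  · have h : ∀ x y z w : Fin 5, treeRel ZStruc x y z w ↔
        quart ZStruc x z y w ∨ quart ZStruc x w y z := by
      simp only [quart, treeRel_ZStruc]
      set_option synthInstance.maxSize 1000 in
      decide +kernel
    exact h
  · have h : ∀ x y z w : Fin 5, [x, y, z, w].Nodup →
        quart ZStruc x y z w ∨ quart ZStruc x z y w ∨ quart ZStruc x w y z := by
      simp only [quart, treeRel_ZStruc]
      set_option synthInstance.maxSize 1000 in
      decide +kernel
    exact h

/-- An injection from a resolved structure which preserves quartets is an embedding. -/
def Emb.ofResolved {W X : Struc treeSig} (hW : IsResolved W) (hX : IsQuartetStruc X)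
    (g : W.carrier → X.carrier) (hg : Function.Injective g)
    (h : ∀ x y z w, quart W x y z w → quart X (g x) (g y) (g z) (g w)) : Emb W X :=
  Emb.ofTreeRel g hg fun x y z w => by
    have hQ := hX.isQuartet
    rw [hX.rel_iff, hW.rel_iff]
    refine ⟨fun hq => ?_, Or.imp (h _ _ _ _) (h _ _ _ _)⟩
    have hn : [x, y, z, w].Nodup := by
      refine List.Nodup.of_map g ?_
      rcases hq with hq | hq <;> have := hQ.nodup hq <;> simp at this ⊢ <;> grind
    rcases hW.exists_quart x y z w hn with h' | h'
    · have h'' := h _ _ _ _ h'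
      rcases hq with hq | hq
      · exact (hQ.thin h'' hq).elim
      · exact (hQ.thin' h'' hq).elim
    · exact h'

theorem isMarkedY_of_quart {X : Struc treeSig} (hX : IsQuartetStruc X) {a p q r : X.carrier}
    (h : quart X a p q r) (hall : ∀ x, x ∈ [a, p, q, r]) : IsMarkedY X a := by
  have hn := hX.isQuartet.nodup h
  have hbase : ∀ x y z w : Fin 4, quart YStruc x y z w →
      (x, y, z, w) ∈ quartetOrbit (0 : Fin 4) 1 2 3 := by
    simp only [quart, treeRel_YStruc]
    decide +kernel
  refine ⟨Emb.ofResolved isResolved_YStruc hX [a, p, q, r].get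
    (List.nodup_iff_injective_get.mp hn) fun x y z w hq => ?_, fun x => ?_, rfl⟩
  · refine hX.isQuartet.of_mem_quartetOrbit h ?_
    exact List.mem_map_of_mem (f := fun t : Fin 4 × Fin 4 × Fin 4 × Fin 4 =>
      ([a, p, q, r].get t.1, [a, p, q, r].get t.2.1, [a, p, q, r].get t.2.2.1,
        [a, p, q, r].get t.2.2.2)) (hbase x y z w hq)
  · exact List.mem_iff_get.mp (hall x)

theorem isMarkedZ_of_quart {X : Struc treeSig} (hX : IsQuartetStruc X) {a p q r s : X.carrier}
    (h₀ : quart X p q r s) (h₁ : quart X a q r s) (h₂ : quart X p a r s) (h₃ : quart X p q a s)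
    (h₄ : quart X p q r a) (hall : ∀ x, x ∈ [p, q, r, s, a]) : IsMarkedZ X a := by
  have hQ := hX.isQuartet
  have hn : [p, q, r, s, a].Nodup := by
    have := hQ.nodup h₀
    have := hQ.nodup h₁
    have := hQ.nodup h₂
    simp at *
    grind
  have hbase : ∀ x y z w : Fin 5, quart ZStruc x y z w →
      (x, y, z, w) ∈ quartetOrbit (0 : Fin 5) 1 2 3 ++ quartetOrbit 4 1 2 3 ++
        quartetOrbit 0 4 2 3 ++ quartetOrbit 0 1 4 3 ++ quartetOrbit 0 1 2 4 := by
    simp only [quart, treeRel_ZStruc]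
    set_option synthInstance.maxSize 1000 in
    decide +kernel
  refine ⟨Emb.ofResolved isResolved_ZStruc hX [p, q, r, s, a].get
    (List.nodup_iff_injective_get.mp hn) fun x y z w hq => ?_, fun x => ?_, rfl⟩
  · have hmem := List.mem_map_of_mem (f := fun t : Fin 5 × Fin 5 × Fin 5 × Fin 5 =>
      ([p, q, r, s, a].get t.1, [p, q, r, s, a].get t.2.1, [p, q, r, s, a].get t.2.2.1,
        [p, q, r, s, a].get t.2.2.2)) (hbase x y z w hq)
    simp only [List.map_append, List.mem_append] at hmem
    rcases hmem with (((hmem | hmem) | hmem) | hmem) | hmem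
    · exact hQ.of_mem_quartetOrbit h₀ hmem
    · exact hQ.of_mem_quartetOrbit h₁ hmem
    · exact hQ.of_mem_quartetOrbit h₂ hmem
    · exact hQ.of_mem_quartetOrbit h₃ hmem
    · exact hQ.of_mem_quartetOrbit h₄ hmem
  · exact List.mem_iff_get.mp (hall x)

/-! # Minimal marked trees -/

section Twins

variable {α : Type*} {Q : α → α → α → α → Prop} {a : α}

theorem Twins.replace (h : ∀ b ≠ a, Twins Q a b) (hQ : IsQuartet Q) {p q r s w : α}
    (hp : Q p q r s) (ha : a ∉ [p, q, r, s]) (hw : w ∉ [p, q, r, s]) : Q w q r s := by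
  have hn := List.nodup_cons.mp (hQ.nodup hp)
  have ha' : a ∉ [q, r, s] := fun h => ha (.tail _ h)
  have haq : Q a q r s := (h p (fun e => ha (by simp [e])) q r s ha' hn.1).mpr hp
  by_cases hwa : w = a
  · rwa [hwa]
  · exact (h w hwa q r s ha' fun h => hw (.tail _ h)).mp haq

theorem Twins.exists_quart (h : ∀ b ≠ a, Twins Q a b) (hQ : IsQuartet Q) {p q r s : α}
    (hp : Q p q r s) : ∃ p q r, Q a p q r := by
  by_cases ha : a ∈ [p, q, r, s]
  · simp only [List.mem_cons, List.not_mem_nil, or_false] at ha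
    rcases ha with rfl | rfl | rfl | rfl
    · exact ⟨_, _, _, hp⟩
    · exact ⟨_, _, _, hQ.swap hp⟩
    · exact ⟨_, _, _, hQ.flip hp⟩
    · exact ⟨_, _, _, hQ.flip (hQ.swap_right hp)⟩
  · exact ⟨_, _, _, replace h hQ hp ha ha⟩

/-- If all elements are twins of `a`, then any quartet avoiding `a` covers everything else. -/
theorem Twins.mem_of_quart (h : ∀ b ≠ a, Twins Q a b) (hQ : IsQuartet Q) {p q r s : α}
    (hp : Q p q r s) (ha : a ∉ [p, q, r, s]) (w : α) : w ∈ [p, q, r, s, a] := by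
  by_contra hw
  simp only [List.mem_cons, List.not_mem_nil, or_false, not_or] at ha hw
  have h1 : Q w r p q := replace h hQ (hQ.flip (hQ.swap_right hp)) (by simp [ha]) (by simp [hw])
  have h2 : Q w p r s := replace h hQ (hQ.swap hp) (by simp [ha]) (by simp [hw])
  have haw : a ≠ w := Ne.symm hw.2.2.2.2
  have e1 : Q a p r w := replace h hQ (hQ.swap (hQ.swap_right (hQ.flip h1)))
    (by simp [ha, haw]) (by simp [ha, haw])
  have e2 : Q a r p w := replace h hQ (hQ.swap (hQ.flip (hQ.swap h2)))
    (by simp [ha, haw]) (by simp [ha, haw])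
  exact hQ.thin e1 e2

end Twins

theorem MinimalMarked.isMarked {X : Struc treeSig} (hX : IsQuartetStruc X) {a : X.carrier}
    (h : MinimalMarked TreeClass X a) :
    (∃ (m : ℕ) (hm : 0 < m), IsMarkedXm m hm X a) ∨ IsMarkedY X a ∨ IsMarkedZ X a := by
  have hQ := hX.isQuartet
  have htwins : ∀ b ≠ a, Twins (quart X) a b := fun b hb => by
    by_contra hn
    exact h b ⟨hb.symm, separated_of_not_twins hX hb.symm hn⟩
  by_cases hrel : ∀ x y z w, ¬ treeRel X x y z w
  · exact Or.inl (isMarkedXm_of_forall_not_treeRel hrel a)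
  refine Or.inr ?_
  push Not at hrel
  obtain ⟨x, y, z, w, hrel⟩ := hrel
  obtain ⟨p, q, r, hp⟩ : ∃ p q r, quart X a p q r := by
    rcases (hX.rel_iff x y z w).mp hrel with hq | hq <;> exact Twins.exists_quart htwins hQ hq
  by_cases hall : ∀ t, t ∈ [a, p, q, r]
  · exact Or.inl (isMarkedY_of_quart hX hp hall)
  push Not at hall
  obtain ⟨t, ht⟩ := hall
  have hn := hQ.nodup hp
  have hta : t ≠ a := fun h => ht (by simp [h])
  have htq : quart X t p q r :=
    (htwins t hta p q r (by simp at hn ⊢; grind) (by simp at ht ⊢; grind)).mp hp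
  have ha : a ∉ [t, p, q, r] := by simp at hn ⊢; grind
  have ha' := ha
  simp only [List.mem_cons, List.not_mem_nil, or_false, not_or] at ha'
  have h₂ := Twins.replace (w := a) htwins hQ (hQ.swap htq) (by simp [ha']) (by simp [ha'])
  have h₃ := Twins.replace (w := a) htwins hQ (hQ.flip htq) (by simp [ha']) (by simp [ha'])
  have h₄ := Twins.replace (w := a) htwins hQ (hQ.flip (hQ.swap_right htq))
    (by simp [ha']) (by simp [ha'])
  exact Or.inr (isMarkedZ_of_quart hX htq hp (hQ.swap h₂) (hQ.flip h₃)
    (hQ.swap_right (hQ.flip h₄)) (Twins.mem_of_quart htwins hQ htq ha))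

end Paper

namespace Paper

/-- **Classification of minimal marked trees** (Proposition 3.5(a)): a marked tree
structure `(X, a)` is minimal relative to `𝔗` iff it is isomorphic as a marked structure
to the marked leaf structure of one of `X_m` (`m ≥ 1`), `Y`, or `Z`. -/
theorem minimal_marked_tree_iff (X : Struc treeSig) (hX : X ∈ TreeClass) (a : X.carrier) :
    MinimalMarked TreeClass X a ↔
      ((∃ (m : ℕ) (hm : 0 < m), IsMarkedXm m hm X a) ∨ IsMarkedY X a ∨ IsMarkedZ X a) := by
  refine ⟨MinimalMarked.isMarked (isQuartetStruc_of_memUpIso (memUpIso_of_mem hX)), ?_⟩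
  rintro (⟨_, _, h⟩ | h | h)
  · exact h.minimalMarked
  · exact h.minimalMarked
  · exact h.minimalMarked

end Paper
end
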